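/- For every ε > 0 there exists a threshold p_0 such that for every prime p ≥ p_0 and every integer a with a ≢ 0 (mod p), there exist positive integers n_1,…,n_7 with n_i ≤ p^{11/12+ε} for all i and n_1! n_2! ⋯ n_7! ≡ a (mod p). -/

import Mathlib

section

open Polynomial Finset

/-- Multiplying by `f ^ m` and taking the `l`-th Hasse derivative is, up to powers of `f`, a linear
operator that raises degrees by at most `l * natDegree f`. -/
theorem exists_hasseDeriv_pow_mul {K : Type*} [Field K] (f : K[X]) (m : ℕ) :
    ∀ l : ℕ, ∃ T : K[X] →ₗ[K] K[X], ∀ k : K[X],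
      f ^ l * hasseDeriv l (f ^ m * k) = f ^ m * T k ∧
        (T k).natDegree ≤ k.natDegree + l * f.natDegree := by
  induction m with
  | zero =>
    intro l
    refine ⟨(LinearMap.mulLeft K (f ^ l)).comp (hasseDeriv l), fun k => ⟨by simp, ?_⟩⟩
    simp only [LinearMap.comp_apply, LinearMap.mulLeft_apply]
    refine natDegree_mul_le.trans ?_
    have h1 := natDegree_pow_le (p := f) (n := l)
    have h2 := natDegree_hasseDeriv_le k l
    omega
  | succ m ih =>
    intro l
    choose T hT using ih
    refine ⟨T l + ∑ u ∈ range l, (LinearMap.mulLeft K (f ^ u * hasseDeriv (u + 1) f)).comp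
      (T (l - (u + 1))), fun k => ⟨?_, ?_⟩⟩
    · have : f ^ (m + 1) * k = f * (f ^ m * k) := by ring
      rw [this, hasseDeriv_mul, Finset.Nat.sum_antidiagonal_eq_sum_range_succ
        (fun u v => hasseDeriv u f * hasseDeriv v (f ^ m * k)), sum_range_succ']
      simp only [LinearMap.add_apply, LinearMap.sum_apply, LinearMap.comp_apply,
        LinearMap.mulLeft_apply, hasseDeriv_zero', Nat.sub_zero]
      rw [mul_add, mul_add, add_comm, mul_sum, mul_sum]
      congr 1
      · linear_combination f * (hT l k).1
      · refine sum_congr rfl fun u hu => ?_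
        have hl : f ^ l = f ^ (u + 1) * f ^ (l - (u + 1)) := by
          rw [← pow_add]; congr 1; have := mem_range.1 hu; omega
        rw [hl]
        linear_combination f ^ (u + 1) * hasseDeriv (u + 1) f * (hT (l - (u + 1)) k).1
    · rw [LinearMap.add_apply, LinearMap.sum_apply]
      refine (natDegree_add_le _ _).trans (max_le (hT l k).2 ?_)
      refine natDegree_sum_le_of_forall_le _ _ fun u hu => ?_
      simp only [LinearMap.comp_apply, LinearMap.mulLeft_apply]
      refine natDegree_mul_le.trans ?_
      have h0 := natDegree_mul_le (p := f ^ u) (q := hasseDeriv (u + 1) f)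
      have h1 := natDegree_pow_le (p := f) (n := u)
      have h2 := natDegree_hasseDeriv_le f (u + 1)
      have h3 := (hT (l - (u + 1)) k).2
      have h4 : l * f.natDegree
          = u * f.natDegree + f.natDegree + (l - (u + 1)) * f.natDegree := by
        have : l = u + 1 + (l - (u + 1)) := by have := mem_range.1 hu; omega
        conv_lhs => rw [this]
        ring
      omega

/-- Polynomials of degree `< t`, multiplied by powers of `X - a` whose exponents are at least `t`
apart and by polynomials not vanishing at `a`, are linearly independent. -/
theorem eq_zero_of_sum_X_sub_C_pow_mul_eq_zero {K ι : Type*} [Field K] [Fintype ι] (a : K)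
    (t : ℕ) (s : ι → ℕ) (hs : ∀ x y, x ≠ y → s x ≤ s y → s x + t ≤ s y) (u k : ι → K[X])
    (hu : ∀ x, (u x).eval a ≠ 0) (hk : ∀ x, (k x).degree < t)
    (h : ∑ x, (X - C a) ^ s x * u x * k x = 0) (x : ι) : k x = 0 := by
  classical
  by_contra hx
  obtain ⟨y, hy, hmin⟩ := exists_min_image (univ.filter fun x => k x ≠ 0) s ⟨x, by simpa using hx⟩
  have hy' : k y ≠ 0 := by simpa using hy
  apply hy'
  have hdvd : (X - C a) ^ (s y + t) ∣ (X - C a) ^ s y * u y * k y := by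
    rw [← add_sum_erase _ _ (mem_univ y)] at h
    rw [eq_neg_of_add_eq_zero_left h, dvd_neg]
    refine dvd_sum fun z hz => ?_
    by_cases hz0 : k z = 0
    · simp [hz0]
    · rw [mul_assoc]
      refine Dvd.dvd.mul_right (pow_dvd_pow _ ?_) _
      exact hs y z (ne_of_mem_erase hz).symm (hmin z (by simpa using hz0))
  rw [pow_add, mul_assoc] at hdvd
  have h1 := (mul_dvd_mul_iff_left (pow_ne_zero _ (X_sub_C_ne_zero a))).1 hdvd
  have hcop : IsCoprime ((X - C a) ^ t) (u y) := by
    apply IsCoprime.pow_left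
    rw [(irreducible_X_sub_C a).coprime_iff_not_dvd, dvd_iff_isRoot]
    exact hu y
  have h2 := hcop.dvd_of_dvd_mul_left h1
  by_contra h0
  have h3 := degree_le_of_dvd h2 h0
  rw [degree_pow, degree_X_sub_C] at h3
  have h4 := hk y
  simp only [nsmul_eq_mul, mul_one] at h3
  exact absurd (lt_of_lt_of_le h4 h3) (lt_irrefl _)

theorem X_sub_C_pow_dvd_of_hasseDeriv {K : Type*} [Field K] (R : K[X]) (x : K) (M : ℕ)
    (h : ∀ l < M, (hasseDeriv l R).eval x = 0) : (X - C x) ^ M ∣ R := by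
  have h1 : X ^ M ∣ taylor x R := by
    rw [X_pow_dvd_iff]
    intro l hl
    rw [taylor_coeff, h l hl]
  obtain ⟨g, hg⟩ := h1
  refine ⟨taylor (-x) g, ?_⟩
  have h2 := congrArg (taylor (-x)) hg
  rw [taylor_taylor, taylor_mul, taylor_pow, taylor_X] at h2
  simpa [sub_eq_add_neg] using h2

/-- Stepanov's auxiliary polynomial bound for the number of points of a level set of `f ^ t`. -/
theorem stepanov_card_mul_le {K : Type*} [Field K] (p n e t d J M : ℕ) [Fact p.Prime] [CharP K p]
    (het : e * t + 1 = p ^ n) (ht : 0 < t) (f h : K[X]) (a c : K) (hf : f = (X - C a) * h)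
    (hd : f.natDegree = d) (ha : h.eval a ≠ 0) (haq : a ^ p ^ n = a) (hc : c ≠ 0) (Z : Finset K)
    (hZ : ∀ x ∈ Z, x ^ p ^ n = x ∧ f.eval x ^ t = c) (hM : M ≤ p ^ n)
    (hMJ : M * (t + M * d + J) < e * J * t) :
    M * Z.card ≤ p ^ n * d + t + J * p ^ n := by
  classical
  set q := p ^ n with hq
  choose T hT using fun m => exists_hasseDeriv_pow_mul f m
  let S : ℕ → (Fin e × Fin J → degreeLT K t) →ₗ[K] K[X] := fun l =>
    ∑ x : Fin e × Fin J, (LinearMap.mulLeft K ((X - C a) ^ (x.2 : ℕ) * C (c ^ (x.1 : ℕ)))).comp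
      ((T ((x.1 : ℕ) * t) l).comp ((degreeLT K t).subtype.comp (LinearMap.proj x)))
  have hS : ∀ l k, S l k = ∑ x : Fin e × Fin J, (X - C a) ^ (x.2 : ℕ) * C (c ^ (x.1 : ℕ)) *
      T ((x.1 : ℕ) * t) l (k x : K[X]) := by
    intro l k
    simp [S, LinearMap.sum_apply, mul_assoc]
  have hkdeg : ∀ k : degreeLT K t, (k : K[X]).natDegree < t := by
    intro k
    rcases eq_or_ne (k : K[X]) 0 with h0 | h0
    · simpa [h0] using ht
    · exact (natDegree_lt_iff_degree_lt h0).2 (mem_degreeLT.1 k.2)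
  have hSdeg : ∀ (l : Fin M) k, S l k ∈ degreeLT K (t + M * d + J) := by
    intro l k
    rw [hS]
    refine Submodule.sum_mem _ fun x _ => ?_
    rw [mem_degreeLT]
    refine lt_of_le_of_lt degree_le_natDegree ?_
    norm_cast
    have h1 := (hT ((x.1 : ℕ) * t) l (k x : K[X])).2
    have h2 := hkdeg (k x)
    have h3 : ((X - C a) ^ (x.2 : ℕ) * C (c ^ (x.1 : ℕ))).natDegree ≤ (x.2 : ℕ) := by
      refine (natDegree_mul_C_le _ _).trans ?_
      simp
    have h4 := natDegree_mul_le (p := (X - C a) ^ (x.2 : ℕ) * C (c ^ (x.1 : ℕ)))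
      (q := T ((x.1 : ℕ) * t) l (k x : K[X]))
    have h5 : (l : ℕ) * d ≤ M * d := Nat.mul_le_mul_right _ l.2.le
    have h6 := x.2.2
    rw [hd] at h1
    omega
  let Φ : (Fin e × Fin J → degreeLT K t) →ₗ[K] (Fin M → degreeLT K (t + M * d + J)) :=
    LinearMap.pi fun l => (S l).codRestrict _ (hSdeg l)
  have hfin : ∀ N, Module.finrank K (degreeLT K N) = N := by
    intro N
    rw [LinearEquiv.finrank_eq (degreeLTEquiv K N)]
    simp
  have : ∀ N, Module.Finite K (degreeLT K N) := fun N =>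
    Module.Finite.equiv (degreeLTEquiv K N).symm
  have hker : LinearMap.ker Φ ≠ ⊥ := by
    apply LinearMap.ker_ne_bot_of_finrank_lt
    rw [Module.finrank_pi_fintype, Module.finrank_pi_fintype]
    simp only [hfin, sum_const, card_univ, Fintype.card_prod, Fintype.card_fin, smul_eq_mul]
    exact hMJ
  obtain ⟨k, hk, hk0⟩ := (Submodule.ne_bot_iff _).1 hker
  have hk' : ∀ l < M, S l k = 0 := by
    intro l hl
    have := congrFun (LinearMap.mem_ker.1 hk) ⟨l, hl⟩
    simpa [Φ] using congrArg Subtype.val this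
  set R : K[X] := ∑ x : Fin e × Fin J, f ^ ((x.1 : ℕ) * t) * (k x : K[X]) *
    ((X - C a) ^ q) ^ (x.2 : ℕ) with hR
  have hR0 : R ≠ 0 := by
    intro h0
    apply hk0
    funext x
    apply Subtype.ext
    refine eq_zero_of_sum_X_sub_C_pow_mul_eq_zero a t
      (fun x : Fin e × Fin J => (x.1 : ℕ) * t + q * x.2) ?_
      (fun x => h ^ ((x.1 : ℕ) * t)) (fun x => (k x : K[X])) ?_ ?_ ?_ x
    · rintro ⟨i, j⟩ ⟨i', j'⟩ hne hle
      simp only at hle ⊢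
      have hi : (i : ℕ) * t + t ≤ e * t := by
        have : ((i : ℕ) + 1) * t ≤ e * t := Nat.mul_le_mul_right _ i.2
        linarith
      have hi' : (i' : ℕ) * t + t ≤ e * t := by
        have : ((i' : ℕ) + 1) * t ≤ e * t := Nat.mul_le_mul_right _ i'.2
        linarith
      rcases lt_trichotomy (j : ℕ) j' with hj | hj | hj
      · have : q * ((j : ℕ) + 1) ≤ q * j' := Nat.mul_le_mul_left _ hj
        rw [mul_add, mul_one] at this
        omega
      · have hij : (i : ℕ) ≠ i' := by
          intro h'
          exact hne (Prod.ext (Fin.ext h') (Fin.ext hj))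
        rw [hj] at hle ⊢
        have hlt : (i : ℕ) < i' := by
          refine lt_of_le_of_ne ?_ hij
          exact Nat.le_of_mul_le_mul_right (by omega) ht
        have : ((i : ℕ) + 1) * t ≤ i' * t := Nat.mul_le_mul_right _ hlt
        rw [add_mul, one_mul] at this
        omega
      · exfalso
        have : q * ((j' : ℕ) + 1) ≤ q * j := Nat.mul_le_mul_left _ hj
        rw [mul_add, mul_one] at this
        omega
    · intro x
      rw [eval_pow]
      exact pow_ne_zero _ ha
    · intro x
      exact mem_degreeLT.1 (k x).2
    · rw [← h0, hR]
      refine sum_congr rfl fun x _ => ?_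
      rw [hf, mul_pow, pow_add, pow_mul (X - C a) q]
      ring
  have hdvd : ∀ x ∈ Z, (X - C x) ^ M ∣ R := by
    intro x hx
    obtain ⟨hxq, hxc⟩ := hZ x hx
    have hfx : f.eval x ≠ 0 := by
      intro h0
      rw [h0, zero_pow ht.ne'] at hxc
      exact hc hxc.symm
    set R' : K[X] := ∑ y : Fin e × Fin J, f ^ ((y.1 : ℕ) * t) * (k y : K[X]) *
      C (x - a) ^ (y.2 : ℕ) with hR'
    have h1 : (X - C x) ^ M ∣ R - R' := by
      rw [hR, hR', ← sum_sub_distrib]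
      refine dvd_sum fun y _ => ?_
      rw [← mul_sub]
      refine Dvd.dvd.mul_left ((pow_dvd_pow _ hM).trans ?_) _
      refine dvd_trans (dvd_of_eq ?_) (sub_dvd_pow_sub_pow _ _ _)
      have hchar : CharP K[X] p := inferInstance
      rw [hq, sub_pow_char_pow, sub_pow_char_pow, ← C_pow, ← C_pow, hxq, haq, C_sub]
      ring
    have h2 : (X - C x) ^ M ∣ R' := by
      apply X_sub_C_pow_dvd_of_hasseDeriv
      intro l hl
      have h3 := congrArg (eval x) (hk' l hl)
      rw [hS, eval_finsetSum, eval_zero] at h3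
      have h4 : f.eval x ^ l * (hasseDeriv l R').eval x = 0 := by
        rw [← h3, hR', map_sum, eval_finsetSum, mul_sum]
        refine sum_congr rfl fun y _ => ?_
        have h5 := congrArg (eval x) (hT ((y.1 : ℕ) * t) l (k y : K[X])).1
        have h6 : f ^ ((y.1 : ℕ) * t) * (k y : K[X]) * C (x - a) ^ (y.2 : ℕ)
            = (x - a) ^ (y.2 : ℕ) • (f ^ ((y.1 : ℕ) * t) * (k y : K[X])) := by
          rw [smul_eq_C_mul, C_pow]; ring
        rw [h6, LinearMap.map_smul, eval_smul, smul_eq_mul]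
        simp only [eval_mul, eval_pow, eval_sub, eval_X, eval_C] at h5 ⊢
        have h7 : eval x f ^ ((y.1 : ℕ) * t) = c ^ (y.1 : ℕ) := by rw [mul_comm, pow_mul, hxc]
        rw [h7] at h5
        linear_combination (x - a) ^ (y.2 : ℕ) * h5
      exact (mul_eq_zero.1 h4).resolve_left (pow_ne_zero _ hfx)
    have := dvd_add h1 h2
    simpa using this
  have hprod : ∏ x ∈ Z, (X - C x) ^ M ∣ R := by
    refine Finset.prod_dvd_of_coprime ?_ hdvd
    intro x _ y _ hxy
    exact IsCoprime.pow (isCoprime_X_sub_C_of_isUnit_sub (sub_ne_zero.2 hxy).isUnit)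
  have h1 := natDegree_le_of_dvd hprod hR0
  rw [natDegree_prod _ _ fun x _ => pow_ne_zero _ (X_sub_C_ne_zero x)] at h1
  simp only [natDegree_pow, natDegree_X_sub_C, mul_one, sum_const, smul_eq_mul] at h1
  have h2 : R.natDegree ≤ q * d + t + J * q := by
    refine natDegree_sum_le_of_forall_le _ _ fun x _ => ?_
    refine natDegree_mul_le.trans ?_
    have a1 := natDegree_mul_le (p := f ^ ((x.1 : ℕ) * t)) (q := (k x : K[X]))
    have a2 := natDegree_pow_le (p := f) (n := (x.1 : ℕ) * t)
    have a3 := hkdeg (k x)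
    have a4 : (((X - C a) ^ q) ^ (x.2 : ℕ)).natDegree = x.2 * q := by
      simp
    have a5 : (x.1 : ℕ) * t * d ≤ q * d := by
      apply Nat.mul_le_mul_right
      have : (x.1 : ℕ) * t ≤ e * t := Nat.mul_le_mul_right _ x.1.2.le
      omega
    have a6 : (x.2 : ℕ) * q ≤ J * q := Nat.mul_le_mul_right _ x.2.2.le
    rw [hd] at a2
    omega
  rw [mul_comm]
  exact h1.trans h2

/-- The numerical choice of parameters in Stepanov's method. -/
theorem exists_stepanov_constant (e d : ℕ) (he : 1 ≤ e) :
    ∃ C : ℝ, 0 ≤ C ∧ ∀ Q t z : ℕ, e ≤ Q → 2 ≤ Q → e * t + 1 = Q ^ 2 → 0 < t → z ≤ Q ^ 2 →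
      (∀ J M : ℕ, M ≤ Q ^ 2 → M * (t + M * d + J) < e * J * t →
        M * z ≤ Q ^ 2 * d + t + J * Q ^ 2) →
      (e * z : ℝ) ≤ Q ^ 2 + C * Q := by
  set δ : ℕ := 2 * e * (e ^ 2 * d + e) + 1 with hδ
  refine ⟨2 * (δ + d + 1), by positivity, fun Q t z heQ hQ het ht hz h => ?_⟩
  rcases lt_or_ge (e * Q) (2 * δ) with hlt | hge
  · have h1 : e * z ≤ 2 * δ * Q := by
      calc e * z ≤ e * Q ^ 2 := Nat.mul_le_mul_left _ hz
        _ = e * Q * Q := by ring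
        _ ≤ 2 * δ * Q := Nat.mul_le_mul_right _ hlt.le
    have h2 : (e * z : ℝ) ≤ 2 * δ * Q := by exact_mod_cast h1
    have : (0 : ℝ) ≤ (d + 1) * Q := by positivity
    nlinarith [sq_nonneg (Q : ℝ)]
  · obtain ⟨M, hM⟩ : ∃ M, M + δ = e * Q := ⟨e * Q - δ, by omega⟩
    have hMle : M ≤ e * Q := by omega
    have hMQ : M ≤ Q ^ 2 := by
      calc M ≤ e * Q := hMle
        _ ≤ Q * Q := Nat.mul_le_mul_right _ heQ
        _ = Q ^ 2 := by ring
    have key := h Q M hMQ (by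
      have h1 : M * (M * d + Q) ≤ e * Q * (e * Q * d + Q) := by gcongr
      have h2 : e * Q * (e * Q * d + Q) = Q ^ 2 * (e ^ 2 * d + e) := by ring
      have h3 : Q ^ 2 ≤ 2 * (e * t) := by
        have : 2 ^ 2 ≤ Q ^ 2 := Nat.pow_le_pow_left hQ 2
        omega
      have h4 : Q ^ 2 * (e ^ 2 * d + e) ≤ 2 * (e * t) * (e ^ 2 * d + e) :=
        Nat.mul_le_mul_right _ h3
      have h5 : δ * t = 2 * (e * t) * (e ^ 2 * d + e) + t := by rw [hδ]; ring
      have h6 : e * Q * t = M * t + δ * t := by rw [← hM]; ring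
      have h7 : M * (t + M * d + Q) = M * t + M * (M * d + Q) := by ring
      omega)
    have keyR : (M * z : ℝ) ≤ Q ^ 2 * d + t + Q * Q ^ 2 := by exact_mod_cast key
    have hMR : (M : ℝ) + δ = e * Q := by exact_mod_cast hM
    have hgeR : (2 * δ : ℝ) ≤ e * Q := by exact_mod_cast hge
    have hetR : (e * t : ℝ) + 1 = Q ^ 2 := by exact_mod_cast het
    have heR : (1 : ℝ) ≤ e := by exact_mod_cast he
    have hδ1 : (1 : ℝ) ≤ δ := by exact_mod_cast (by omega : 1 ≤ δ)
    have hMpos : (0 : ℝ) < M := by linarith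
    have hQR : (0 : ℝ) ≤ Q := by positivity
    refine le_of_mul_le_mul_left ?_ hMpos
    have hM' : (M : ℝ) = e * Q - δ := by linarith
    calc (M : ℝ) * (e * z) = e * (M * z) := by ring
      _ ≤ e * (Q ^ 2 * d + t + Q * Q ^ 2) := by gcongr
      _ ≤ e * Q ^ 3 + e * d * Q ^ 2 + Q ^ 2 := by nlinarith
      _ ≤ M * (Q ^ 2 + 2 * (δ + d + 1) * Q) := by
        rw [hM']
        have h1 : 0 ≤ (e * Q - 2 * δ) * ((δ + d + 1) * Q : ℝ) :=
          mul_nonneg (by linarith) (by positivity)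
        have h2 : 0 ≤ (e - 1) * ((δ : ℝ) + 1) * Q ^ 2 :=
          mul_nonneg (mul_nonneg (by linarith) (by positivity)) (by positivity)
        nlinarith

/-- A crude Weil bound, with an unspecified constant, over the extensions of even degree. -/
theorem exists_norm_sum_extension_le (p : ℕ) [Fact p.Prime] (A : Finset (ZMod p))
    (hA : A.Nonempty) (χ : MulChar (ZMod p) ℂ) (hχ : χ ≠ 1) :
    ∃ C : ℝ, ∀ (s : ℕ) (E : Type) [Field E] [Fintype E] [Algebra (ZMod p) E],
      1 ≤ s → Fintype.card E = p ^ (2 * s) →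
      ‖∑ x : E, ∏ a ∈ A, χ (Algebra.norm (ZMod p) (algebraMap (ZMod p) E a - x))‖ ≤ C * p ^ s := by
  classical
  have hp2 : 2 ≤ p := (Fact.out : p.Prime).two_le
  obtain ⟨D, -, hD⟩ := exists_stepanov_constant (p - 1) A.card (by omega)
  refine ⟨D + A.card, fun s E _ _ _ hs hE => ?_⟩
  have hcharE : CharP E p := charP_of_injective_algebraMap (algebraMap (ZMod p) E).injective p
  obtain ⟨t, ht⟩ : (p - 1) ∣ p ^ (2 * s) - 1 := by
    simpa using Nat.sub_dvd_pow_sub_pow p 1 (2 * s)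
  have hpow : 1 < p ^ (2 * s) := Nat.one_lt_pow (by omega) (by omega)
  have het : (p - 1) * t + 1 = p ^ (2 * s) := by omega
  have htpos : 0 < t := by
    rcases Nat.eq_zero_or_pos t with h0 | h0
    · rw [h0] at het; omega
    · exact h0
  let g : E → ZMod p := fun x => ∏ a ∈ A, Algebra.norm (ZMod p) (algebraMap (ZMod p) E a - x)
  let f : E[X] := ∏ a ∈ A, (C (algebraMap (ZMod p) E a) - X)
  have hgf : ∀ x, algebraMap (ZMod p) E (g x) = f.eval x ^ t := by
    intro x
    simp only [g, f, map_prod, eval_prod, ← prod_pow]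
    refine prod_congr rfl fun a _ => ?_
    rw [FiniteField.algebraMap_norm_eq_pow, Nat.card_eq_fintype_card, hE, Nat.card_zmod, ht,
      Nat.mul_div_cancel_left _ (by omega)]
    simp
  have hfrob : ∀ x : E, x ^ p ^ (2 * s) = x := by
    intro x
    rw [← hE, FiniteField.pow_card]
  obtain ⟨a, ha⟩ := hA
  have hneg : ∀ b : E, C b - X = - (X - C b) := fun b => by ring
  have hdeg : f.natDegree = A.card := by
    simp only [f]
    rw [natDegree_prod _ _ fun b _ => by
      rw [hneg]; exact neg_ne_zero.2 (X_sub_C_ne_zero _)]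
    simp only [hneg, natDegree_neg, natDegree_X_sub_C]
    simp
  have hcount : ∀ c : ZMod p, c ≠ 0 →
      (((p - 1 : ℕ) : ℝ) * ((univ.filter fun x : E => g x = c).card : ℝ)) ≤
        ((p ^ s : ℕ) : ℝ) ^ 2 + D * (p ^ s : ℕ) := by
    intro c hc
    have hps : p ≤ p ^ s := Nat.le_self_pow (by omega) p
    refine hD (p ^ s) t _ (by omega) (by omega) (by rw [het, ← pow_mul, mul_comm]) htpos ?_ ?_
    · refine (card_le_univ _).trans ?_
      rw [hE, ← pow_mul, mul_comm]
    · intro J M hM hMJ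
      rw [← pow_mul, mul_comm s 2] at hM ⊢
      refine stepanov_card_mul_le p (2 * s) (p - 1) t A.card J M het htpos f
        (- ∏ b ∈ A.erase a, (C (algebraMap (ZMod p) E b) - X)) (algebraMap (ZMod p) E a)
        (algebraMap (ZMod p) E c) ?_ hdeg ?_ (hfrob _) ?_ _ ?_ hM hMJ
      · simp only [f]
        rw [← mul_prod_erase _ _ ha]
        ring
      · rw [eval_neg, neg_ne_zero, eval_prod, prod_ne_zero_iff]
        intro b hb
        simp only [eval_sub, eval_C, eval_X]
        rw [sub_ne_zero]
        exact fun h => (ne_of_mem_erase hb) ((algebraMap (ZMod p) E).injective h)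
      · simpa using hc
      · intro x hx
        refine ⟨hfrob x, ?_⟩
        rw [← hgf, (mem_filter.1 hx).2]
  have hzero : (univ.filter fun x : E => g x = 0).card ≤ A.card := by
    have : (univ.filter fun x : E => g x = 0) ⊆ A.image (algebraMap (ZMod p) E) := by
      intro x hx
      have h1 : g x = 0 := (mem_filter.1 hx).2
      obtain ⟨b, hb, hb0⟩ := prod_eq_zero_iff.1 h1
      rw [Algebra.norm_eq_zero_iff] at hb0
      exact mem_image.2 ⟨b, hb, sub_eq_zero.1 hb0⟩
    exact (card_le_card this).trans card_image_le
  set z : ZMod p → ℝ := fun c => ((univ.filter fun x : E => g x = c).card : ℝ) with hz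
  set B : ℝ := ((p ^ s : ℕ) : ℝ) ^ 2 + D * (p ^ s : ℕ) with hB
  have hsumz : ∑ c, z c = ((p ^ s : ℕ) : ℝ) ^ 2 := by
    have := card_eq_sum_card_fiberwise (f := g) (s := univ) (t := univ) (by simp)
    rw [card_univ, hE] at this
    simp only [hz]
    rw [← Nat.cast_sum, ← this]
    push_cast
    rw [← pow_mul, mul_comm]
  have hW : ∑ x : E, ∏ a ∈ A, χ (Algebra.norm (ZMod p) (algebraMap (ZMod p) E a - x))
      = ∑ c, χ c * (z c : ℂ) := by
    rw [← sum_fiberwise univ g]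
    refine sum_congr rfl fun c _ => ?_
    have : ∀ x ∈ univ.filter (fun x : E => g x = c),
        ∏ a ∈ A, χ (Algebra.norm (ZMod p) (algebraMap (ZMod p) E a - x)) = χ c := by
      intro x hx
      rw [← (mem_filter.1 hx).2]
      simp [g, map_prod]
    rw [sum_congr rfl this]
    simp [hz, mul_comm]
  have hchi : ∑ c, χ c = 0 := MulChar.sum_eq_zero_of_ne_one hχ
  have hpc : (((p - 1 : ℕ) : ℝ)) = (p : ℝ) - 1 := by
    rw [Nat.cast_sub (by omega)]; simp
  have hppos : (0 : ℝ) < (p : ℝ) - 1 := by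
    have : (2 : ℝ) ≤ p := by exact_mod_cast hp2
    linarith
  have hmain : ((p - 1 : ℝ) : ℂ) * ∑ c, χ c * (z c : ℂ)
      = - ∑ c, χ c * ((B - (p - 1) * z c : ℝ) : ℂ) := by
    rw [mul_sum, ← sum_neg_distrib]
    have : ∀ c, - (χ c * ((B - (p - 1) * z c : ℝ) : ℂ))
        = ((p - 1 : ℝ) : ℂ) * (χ c * (z c : ℂ)) - χ c * (B : ℂ) := by
      intro c; push_cast; ring
    simp only [this]
    rw [sum_sub_distrib, ← sum_mul, hchi]
    simp
  have hle : ‖((p - 1 : ℝ) : ℂ) * ∑ c, χ c * (z c : ℂ)‖ ≤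
      ∑ c ∈ univ.erase (0 : ZMod p), (B - (p - 1) * z c) := by
    rw [hmain, norm_neg, ← add_sum_erase _ _ (mem_univ (0 : ZMod p)), MulChar.map_zero, zero_mul,
      zero_add]
    refine norm_sum_le_of_le _ fun c hc => ?_
    have h1 : 0 ≤ B - (p - 1) * z c := by
      have := hcount c (ne_of_mem_erase hc)
      rw [hpc] at this
      simp only [hz, hB]
      linarith
    rw [norm_mul, Complex.norm_real, Real.norm_of_nonneg h1]
    have : ‖χ c‖ ≤ 1 := DirichletCharacter.norm_le_one χ c
    nlinarith
  have hsum : ∑ c ∈ univ.erase (0 : ZMod p), (B - (p - 1) * z c)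
      = (p - 1) * (B - ∑ c ∈ univ.erase (0 : ZMod p), z c) := by
    rw [sum_sub_distrib, ← mul_sum, sum_const, card_erase_of_mem (mem_univ _), card_univ,
      ZMod.card, nsmul_eq_mul, hpc]
    ring
  have hz' : ((p ^ s : ℕ) : ℝ) ^ 2 - A.card ≤ ∑ c ∈ univ.erase (0 : ZMod p), z c := by
    have h1 := add_sum_erase univ z (mem_univ (0 : ZMod p))
    have h2 : z 0 ≤ A.card := by simp only [hz]; exact_mod_cast hzero
    linarith
  rw [hW]
  rw [hsum, norm_mul, Complex.norm_real, Real.norm_of_nonneg hppos.le] at hle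
  have h3 := le_of_mul_le_mul_left hle hppos
  have h4 : (1 : ℝ) ≤ (p : ℝ) ^ s := one_le_pow₀ (by exact_mod_cast (by omega : 1 ≤ p))
  have h5 : (A.card : ℝ) ≤ A.card * (p : ℝ) ^ s := by
    nlinarith [(Nat.cast_nonneg A.card : (0 : ℝ) ≤ A.card)]
  push_cast at *
  calc _ ≤ _ := h3
    _ ≤ _ := by linarith

theorem finite_setOf_monic_natDegree_eq (F : Type*) [Field F] [Finite F] (n : ℕ) :
    {g : F[X] | g.Monic ∧ g.natDegree = n}.Finite := by
  refine Set.Finite.of_injOn (f := fun (g : F[X]) (i : Fin (n + 1)) => g.coeff i) (t := Set.univ)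
    (fun _ _ => Set.mem_univ _) ?_ Set.finite_univ
  intro g hg h hh heq
  ext i
  by_cases hi : i < n + 1
  · exact congrFun heq ⟨i, hi⟩
  · rw [coeff_eq_zero_of_natDegree_lt (by rw [hg.2]; omega),
      coeff_eq_zero_of_natDegree_lt (by rw [hh.2]; omega)]

/-- The monic polynomials of degree `n` over a finite field. -/
noncomputable def monicPolys (F : Type*) [Field F] [Finite F] (n : ℕ) : Finset F[X] :=
  (finite_setOf_monic_natDegree_eq F n).toFinset

/-- The monic irreducible polynomials of degree `n` over a finite field. -/
noncomputable def monicIrreds (F : Type*) [Field F] [Finite F] (n : ℕ) : Finset F[X] :=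
  open Classical in (monicPolys F n).filter Irreducible

section MonicSums

variable {F : Type*} [Field F] [Finite F]

theorem mem_monicPolys {n : ℕ} {g : F[X]} : g ∈ monicPolys F n ↔ g.Monic ∧ g.natDegree = n := by
  simp [monicPolys]

theorem mem_monicIrreds {n : ℕ} {g : F[X]} :
    g ∈ monicIrreds F n ↔ (g.Monic ∧ g.natDegree = n) ∧ Irreducible g := by
  simp [monicIrreds, mem_monicPolys]

theorem sum_monicPolys_pow_dvd (v : F[X] →* ℂ) (n d k : ℕ) (P : F[X]) (hP : P ∈ monicIrreds F d) :
    open Classical in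
    ∑ g ∈ monicPolys F n with P ^ k ∣ g, v g =
      if d * k ≤ n then v P ^ k * ∑ g ∈ monicPolys F (n - d * k), v g else 0 := by
  classical
  obtain ⟨⟨hPm, hPd⟩, hPi⟩ := mem_monicIrreds.1 hP
  have hdeg : (P ^ k).natDegree = d * k := by rw [natDegree_pow, hPd, mul_comm]
  split_ifs with h
  · rw [mul_sum]
    symm
    refine sum_bij (fun g _ => P ^ k * g) ?_ ?_ ?_ ?_
    · intro g hg
      obtain ⟨hgm, hgd⟩ := mem_monicPolys.1 hg
      refine mem_filter.2 ⟨mem_monicPolys.2 ⟨(hPm.pow k).mul hgm, ?_⟩, dvd_mul_right _ _⟩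
      rw [(hPm.pow k).natDegree_mul hgm, hdeg, hgd]
      omega
    · intro g _ g' _ heq
      exact mul_left_cancel₀ (hPm.pow k).ne_zero heq
    · intro g hg
      obtain ⟨hg, h, rfl⟩ := mem_filter.1 hg
      obtain ⟨hgm, hgd⟩ := mem_monicPolys.1 hg
      have hhm := (hPm.pow k).of_mul_monic_left hgm
      refine ⟨h, mem_monicPolys.2 ⟨hhm, ?_⟩, rfl⟩
      rw [(hPm.pow k).natDegree_mul hhm, hdeg] at hgd
      omega
    · intro g _
      simp
  · refine sum_eq_zero fun g hg => ?_
    obtain ⟨hg, hdvd⟩ := mem_filter.1 hg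
    obtain ⟨hgm, hgd⟩ := mem_monicPolys.1 hg
    have := natDegree_le_of_dvd hdvd hgm.ne_zero
    omega

theorem natDegree_eq_sum_monicIrreds (n : ℕ) (g : F[X]) (hg : g ∈ monicPolys F n) :
    open Classical in
    ∑ d ∈ Icc 1 n, ∑ P ∈ monicIrreds F d, ∑ k ∈ Icc 1 n, (if P ^ k ∣ g then d else 0) = n := by
  classical
  obtain ⟨hgm, hgd⟩ := mem_monicPolys.1 hg
  have hg0 := hgm.ne_zero
  set S := UniqueFactorizationMonoid.normalizedFactors g with hS
  have hSmon : ∀ P ∈ S, P.Monic := by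
    intro P hP
    rw [← UniqueFactorizationMonoid.normalize_normalized_factor P hP]
    exact monic_normalize (UniqueFactorizationMonoid.ne_zero_of_mem_normalizedFactors hP)
  have hprod : S.prod = g := by
    refine eq_of_monic_of_associated ?_ hgm
      (UniqueFactorizationMonoid.prod_normalizedFactors hg0)
    simpa using monic_multiset_prod_of_monic S id hSmon
  have hcount : ∀ d P, P ∈ monicIrreds F d →
      ∑ k ∈ Icc 1 n, (if P ^ k ∣ g then d else 0) = S.count P * P.natDegree := by
    intro d P hP
    obtain ⟨⟨hPm, hPd⟩, hPi⟩ := mem_monicIrreds.1 hP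
    have hiff : ∀ k, P ^ k ∣ g ↔ k ≤ S.count P := by
      intro k
      rw [pow_dvd_iff_le_emultiplicity,
        UniqueFactorizationMonoid.emultiplicity_eq_count_normalizedFactors hPi hg0,
        hPm.normalize_eq_self]
      exact_mod_cast Iff.rfl
    have hle : S.count P ≤ n := by
      have h1 := natDegree_le_of_dvd ((hiff _).2 le_rfl) hg0
      rw [natDegree_pow, hgd] at h1
      have := hPi.natDegree_pos
      nlinarith
    simp_rw [hiff]
    rw [← sum_filter, sum_const, smul_eq_mul, hPd]
    congr 1
    have : (Icc 1 n).filter (fun k => k ≤ S.count P) = Icc 1 (S.count P) := by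
      ext k; simp only [mem_filter, mem_Icc]; omega
    rw [this]; simp
  rw [sum_congr rfl fun d _ => sum_congr rfl (hcount d)]
  have hdegsum : n = ∑ P ∈ S.toFinset, S.count P * P.natDegree := by
    rw [← hgd, ← hprod, natDegree_multiset_prod_of_monic _ hSmon,
      sum_multiset_map_count]
    simp
  have hmem : ∀ P ∈ S, P ∈ monicIrreds F P.natDegree := fun P hP =>
    mem_monicIrreds.2 ⟨⟨hSmon P hP, rfl⟩,
      UniqueFactorizationMonoid.irreducible_of_normalized_factor P hP⟩
  have hmaps : ∀ P ∈ S.toFinset, P.natDegree ∈ Icc 1 n := by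
    intro P hP
    rw [Multiset.mem_toFinset] at hP
    have h1 := (mem_monicIrreds.1 (hmem P hP)).2.natDegree_pos
    have h2 := natDegree_le_of_dvd (UniqueFactorizationMonoid.dvd_of_mem_normalizedFactors hP) hg0
    exact mem_Icc.2 ⟨h1, h2.trans_eq hgd⟩
  conv_rhs => rw [hdegsum, ← sum_fiberwise_of_maps_to hmaps]
  refine sum_congr rfl fun d _ => ?_
  symm
  refine sum_subset ?_ ?_
  · intro P hP
    obtain ⟨hP', rfl⟩ := mem_filter.1 hP
    exact hmem P (Multiset.mem_toFinset.1 hP')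
  · intro P hP hP'
    have : P ∉ S := fun h => hP' (mem_filter.2 ⟨Multiset.mem_toFinset.2 h, (mem_monicIrreds.1 hP).1.2⟩)
    simp [Multiset.count_eq_zero_of_notMem this]

/-- The recursion linking the coefficients of an `L`-function over `F[X]` and those of its
logarithmic derivative. -/
theorem mul_sum_monicPolys (v : F[X] →* ℂ) (n : ℕ) :
    (n : ℂ) * ∑ g ∈ monicPolys F n, v g =
      ∑ m ∈ Icc 1 n, (∑ d ∈ m.divisors, ∑ P ∈ monicIrreds F d, (d : ℂ) * v P ^ (m / d)) *
        ∑ g ∈ monicPolys F (n - m), v g := by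
  classical
  have h1 : (n : ℂ) * ∑ g ∈ monicPolys F n, v g = ∑ d ∈ Icc 1 n, ∑ k ∈ Icc 1 n,
      if d * k ≤ n then ∑ P ∈ monicIrreds F d,
        d * (v P ^ k * ∑ g ∈ monicPolys F (n - d * k), v g) else 0 := by
    calc (n : ℂ) * ∑ g ∈ monicPolys F n, v g
        = ∑ g ∈ monicPolys F n, ∑ d ∈ Icc 1 n, ∑ P ∈ monicIrreds F d, ∑ k ∈ Icc 1 n,
            (if P ^ k ∣ g then (d : ℂ) * v g else 0) := by
          rw [mul_sum]
          refine sum_congr rfl fun g hg => ?_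
          conv_lhs => rw [← natDegree_eq_sum_monicIrreds n g hg]
          push_cast
          simp_rw [sum_mul, ite_mul, zero_mul]
      _ = ∑ d ∈ Icc 1 n, ∑ P ∈ monicIrreds F d, ∑ k ∈ Icc 1 n, ∑ g ∈ monicPolys F n,
            (if P ^ k ∣ g then (d : ℂ) * v g else 0) := by
          rw [sum_comm]
          refine sum_congr rfl fun d _ => ?_
          rw [sum_comm]
          exact sum_congr rfl fun P _ => sum_comm
      _ = _ := by
          refine sum_congr rfl fun d _ => ?_
          rw [sum_comm]
          refine sum_congr rfl fun k _ => ?_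
          have : ∀ P ∈ monicIrreds F d, ∑ g ∈ monicPolys F n,
              (if P ^ k ∣ g then (d : ℂ) * v g else 0) = if d * k ≤ n then
                d * (v P ^ k * ∑ g ∈ monicPolys F (n - d * k), v g) else 0 := by
            intro P hP
            rw [← sum_filter, ← mul_sum, sum_monicPolys_pow_dvd v n d k P hP]
            split_ifs <;> simp
          rw [sum_congr rfl this]
          split_ifs <;> simp
  rw [h1, ← sum_product', ← sum_filter]
  conv_rhs => rw [sum_congr rfl fun m _ => sum_mul m.divisors _ _, sum_sigma']
  refine sum_bij' (fun x _ => ⟨x.1 * x.2, x.1⟩) (fun y _ => (y.2, y.1 / y.2)) ?_ ?_ ?_ ?_ ?_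
  · rintro ⟨d, k⟩ h
    simp only [mem_filter, mem_product, mem_Icc, mem_sigma, Nat.mem_divisors] at h ⊢
    refine ⟨⟨Nat.mul_pos h.1.1.1 h.1.2.1, h.2⟩, dvd_mul_right _ _, (Nat.mul_pos h.1.1.1 h.1.2.1).ne'⟩
  · rintro ⟨m, d⟩ h
    simp only [mem_filter, mem_product, mem_Icc, mem_sigma, Nat.mem_divisors] at h ⊢
    obtain ⟨⟨hm1, hmn⟩, ⟨k, rfl⟩, hne⟩ := h
    have hd : 0 < d := by
      rcases Nat.eq_zero_or_pos d with h | h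
      · simp [h] at hne
      · exact h
    have hk : 0 < k := by
      rcases Nat.eq_zero_or_pos k with h | h
      · simp [h] at hne
      · exact h
    rw [Nat.mul_div_cancel_left _ hd]
    refine ⟨⟨⟨hd, ?_⟩, hk, ?_⟩, hmn⟩ <;> nlinarith
  · rintro ⟨d, k⟩ h
    simp only [mem_filter, mem_product, mem_Icc] at h
    simp [Nat.mul_div_cancel_left _ h.1.1.1]
  · rintro ⟨m, d⟩ h
    simp only [mem_sigma, Nat.mem_divisors] at h
    simp [Nat.mul_div_cancel' h.2.1]
  · rintro ⟨d, k⟩ h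
    simp only [mem_filter, mem_product, mem_Icc] at h
    simp only [Nat.mul_div_cancel_left _ h.1.1.1, sum_mul, mul_assoc]

end MonicSums

theorem norm_algebraMap_sub_eq_eval_minpoly {K L : Type*} [Field K] [Field L] [Algebra K L]
    [FiniteDimensional K L] (a : K) (x : L) :
    Algebra.norm K (algebraMap K L a - x) =
      (minpoly K x).eval a ^ (Module.finrank K L / (minpoly K x).natDegree) := by
  have hx : IsIntegral K x := Algebra.IsIntegral.isIntegral x
  have hy : IsIntegral K (x - algebraMap K L a) := Algebra.IsIntegral.isIntegral _
  have hneg : algebraMap K L a - x = algebraMap K L (-1) * (x - algebraMap K L a) := by simp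
  have hmin : minpoly K (x - algebraMap K L a) = (minpoly K x).comp (X + C a) :=
    minpoly.sub_algebraMap x a
  have hdeg : (minpoly K (x - algebraMap K L a)).natDegree = (minpoly K x).natDegree := by
    rw [hmin, natDegree_comp]; simp
  have hpos : 0 < (minpoly K x).natDegree := minpoly.natDegree_pos hx
  have hfr : Module.finrank K (IntermediateField.adjoin K {x - algebraMap K L a}) =
      (minpoly K x).natDegree := by
    rw [IntermediateField.adjoin.finrank hy, hdeg]
  have hmul := Module.finrank_mul_finrank K
    (IntermediateField.adjoin K {x - algebraMap K L a}) L
  rw [hfr] at hmul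
  have hgen : Algebra.norm K (IntermediateField.AdjoinSimple.gen K (x - algebraMap K L a)) =
      (-1) ^ (minpoly K x).natDegree * (minpoly K x).eval a := by
    have h := Algebra.PowerBasis.norm_gen_eq_coeff_zero_minpoly
      (IntermediateField.adjoin.powerBasis hy)
    rw [IntermediateField.adjoin.powerBasis_gen, IntermediateField.adjoin.powerBasis_dim] at h
    rw [h, IntermediateField.minpoly_gen, hdeg, hmin, coeff_zero_eq_eval_zero, eval_comp]
    simp
  rw [hneg, map_mul, Algebra.norm_algebraMap, Algebra.norm_eq_norm_adjoin, hgen, ← hmul,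
    Nat.mul_div_cancel_left _ hpos, mul_pow, ← pow_mul, ← mul_assoc, ← mul_pow]
  simp

section

variable {F : Type*} [Field F] [Finite F]

theorem card_filter_minpoly_eq {E : Type*} [Field E] [Fintype E] [Algebra F E] {d m : ℕ}
    (hE : Module.finrank F E = m) (hd : d ∣ m) (P : F[X]) (hP : P ∈ monicIrreds F d) :
    open Classical in (univ.filter fun x : E => minpoly F x = P).card = d := by
  classical
  obtain ⟨⟨hPm, hPd⟩, hPi⟩ := mem_monicIrreds.1 hP
  have : (univ.filter fun x : E => minpoly F x = P) = (P.rootSet E).toFinset := by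
    ext x
    simp only [mem_filter, mem_univ, true_and, Set.mem_toFinset]
    rw [mem_rootSet]
    constructor
    · rintro rfl
      exact ⟨hPm.ne_zero, minpoly.aeval _ _⟩
    · rintro ⟨-, h⟩
      exact (minpoly.eq_of_irreducible_of_monic hPi h hPm).symm
  rw [this, Set.toFinset_card, card_rootSet_eq_natDegree (PerfectField.separable_of_irreducible hPi), hPd]
  have hcard : Nat.card E = Nat.card F ^ m := by
    rw [← hE]; exact Module.natCard_eq_pow_finrank
  have hdvd := (hPi.natDegree_dvd_iff_dvd_X_pow_card_pow_sub_X (n := m)).1 (hPd ▸ hd)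
  rw [← hcard, Nat.card_eq_fintype_card] at hdvd
  have hs : (X ^ Fintype.card E - X : E[X]).Splits := by
    rw [splits_iff_card_roots, FiniteField.roots_X_pow_card_sub_X,
      FiniteField.X_pow_card_sub_X_natDegree_eq _ Fintype.one_lt_card]
    rfl
  refine Splits.of_dvd hs (FiniteField.X_pow_card_sub_X_ne_zero E Fintype.one_lt_card) ?_
  simpa using map_dvd (algebraMap F E) hdvd

theorem sum_minpoly_eq {E : Type*} [Field E] [Fintype E] [Algebra F E] (m : ℕ)
    (hE : Module.finrank F E = m) (w : F[X] → ℂ) :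
    ∑ x : E, w (minpoly F x) = ∑ d ∈ m.divisors, ∑ P ∈ monicIrreds F d, d * w P := by
  classical
  have hm : m ≠ 0 := by rw [← hE]; exact Module.finrank_pos.ne'
  have hInt : ∀ x : E, IsIntegral F x := fun x => Algebra.IsIntegral.isIntegral x
  have hmaps : ∀ x ∈ (univ : Finset E), (minpoly F x).natDegree ∈ m.divisors := fun x _ => by
    rw [Nat.mem_divisors, ← hE]
    exact ⟨minpoly.degree_dvd (hInt x), hE ▸ hm⟩
  rw [← sum_fiberwise_of_maps_to hmaps]
  refine sum_congr rfl fun d hd => ?_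
  have hmaps' : ∀ x ∈ (univ : Finset E).filter (fun x => (minpoly F x).natDegree = d),
      minpoly F x ∈ monicIrreds F d := fun x hx =>
    mem_monicIrreds.2 ⟨⟨minpoly.monic (hInt x), (mem_filter.1 hx).2⟩, minpoly.irreducible (hInt x)⟩
  rw [← sum_fiberwise_of_maps_to hmaps']
  refine sum_congr rfl fun P hP => ?_
  have h2 : ((univ : Finset E).filter (fun x => (minpoly F x).natDegree = d)).filter
      (fun x => minpoly F x = P) = univ.filter fun x : E => minpoly F x = P := by
    ext x
    simp only [mem_filter, mem_univ, true_and]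
    exact ⟨fun h => h.2, fun h => ⟨h ▸ (mem_monicIrreds.1 hP).1.2, h⟩⟩
  rw [h2, sum_congr rfl (g := fun _ => w P) (fun x hx => by rw [(mem_filter.1 hx).2]), sum_const,
    card_filter_minpoly_eq hE (Nat.dvd_of_mem_divisors hd) P hP, nsmul_eq_mul]

end

/-- The completely multiplicative function `g ↦ ∏ a ∈ A, χ (g a)` on polynomials. -/
noncomputable def evalCharHom {F : Type*} [Field F] (χ : MulChar F ℂ) (A : Finset F) :
    F[X] →* ℂ :=
  ∏ a ∈ A, χ.toMonoidHom.comp (evalRingHom a : F[X] →* F)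

theorem evalCharHom_apply {F : Type*} [Field F] (χ : MulChar F ℂ) (A : Finset F) (g : F[X]) :
    evalCharHom χ A g = ∏ a ∈ A, χ (g.eval a) := by
  simp [evalCharHom, MonoidHom.finsetProd_apply]

theorem sum_monicPolys_evalCharHom_eq_zero {F : Type*} [Field F] [Finite F] (χ : MulChar F ℂ)
    (hχ : χ ≠ 1) (A : Finset F) (hA : A.Nonempty) (n : ℕ) (hn : A.card ≤ n) :
    ∑ g ∈ monicPolys F n, evalCharHom χ A g = 0 := by
  classical
  obtain ⟨u, hu⟩ := MulChar.ne_one_iff.1 hχ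
  obtain ⟨a, ha⟩ := hA
  let l : F[X] := Lagrange.basis A id a
  have hla : l.eval a = 1 := Lagrange.eval_basis_self (v := id) Function.injective_id.injOn ha
  have hlb : ∀ b ∈ A, b ≠ a → l.eval b = 0 := fun b hb hba =>
    Lagrange.eval_basis_of_ne (v := id) hba.symm hb
  have hl : l.degree < n := by
    simp only [l]
    rw [Lagrange.degree_basis Function.injective_id.injOn ha]
    have := card_pos.2 ⟨a, ha⟩
    exact_mod_cast (by omega : A.card - 1 < n)
  let T : Fˣ → F[X] → F[X] := fun w g => g + C ((w - 1) * g.eval a) * l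
  have hTmem : ∀ w, ∀ g ∈ monicPolys F n, T w g ∈ monicPolys F n := by
    intro w g hg
    obtain ⟨hgm, hgd⟩ := mem_monicPolys.1 hg
    have hlt : (C ((w - 1) * g.eval a) * l).degree < g.degree := by
      rw [degree_eq_natDegree hgm.ne_zero, hgd]
      rw [← smul_eq_C_mul]
      exact (degree_smul_le _ _).trans_lt hl
    exact mem_monicPolys.2 ⟨hgm.add_of_left hlt, by
      simp only [T]; rw [natDegree_add_eq_left_of_degree_lt hlt, hgd]⟩
  have hTa : ∀ w g, (T w g).eval a = w * g.eval a := by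
    intro w g
    simp only [T, eval_add, eval_mul, eval_C, hla]
    ring
  have hTb : ∀ w g, ∀ b ∈ A, b ≠ a → (T w g).eval b = g.eval b := by
    intro w g b hb hba
    simp [T, hlb b hb hba]
  have hTinv : ∀ w g, T w⁻¹ (T w g) = g := by
    intro w g
    have : T w⁻¹ (T w g) = T w g + C ((((w⁻¹ : Fˣ) : F) - 1) * (T w g).eval a) * l := rfl
    rw [this, hTa]
    simp only [T]
    rw [add_assoc, ← add_mul, ← C_add]
    have h2 : ((w : F) - 1) * g.eval a + (((w⁻¹ : Fˣ) : F) - 1) * (w * g.eval a) = 0 := by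
      have := w.inv_mul
      linear_combination (g.eval a) * this
    rw [h2]; simp
  have hTv : ∀ g, evalCharHom χ A (T u g) = χ u * evalCharHom χ A g := by
    intro g
    rw [evalCharHom_apply, evalCharHom_apply, ← mul_prod_erase _ _ ha, ← mul_prod_erase _ _ ha,
      hTa, map_mul, mul_assoc]
    congr 2
    refine prod_congr rfl fun b hb => ?_
    rw [hTb u g b (mem_of_mem_erase hb) (ne_of_mem_erase hb)]
  have hsum : ∑ g ∈ monicPolys F n, evalCharHom χ A g =
      χ u * ∑ g ∈ monicPolys F n, evalCharHom χ A g := by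
    rw [mul_sum]
    symm
    refine sum_nbij' (T u) (T u⁻¹) (hTmem u) (hTmem u⁻¹) (fun g _ => hTinv u g)
      (fun g _ => by simpa using hTinv u⁻¹ g) fun g _ => (hTv g).symm
  have : (1 - χ u) * ∑ g ∈ monicPolys F n, evalCharHom χ A g = 0 := by
    rw [sub_mul, one_mul, ← hsum, sub_self]
  rcases mul_eq_zero.1 this with h | h
  · exact absurd (sub_eq_zero.1 h).symm hu
  · exact h

/-- A sequence obeying Newton's recursion with finitely supported coefficients is, up to sign, a
sequence of power sums. -/
theorem exists_powerSums (c W : ℕ → ℂ) (D : ℕ) (hc0 : c 0 = 1) (hcD : ∀ n, D < n → c n = 0)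
    (hrec : ∀ n : ℕ, (n : ℂ) * c n = ∑ m ∈ Icc 1 n, W m * c (n - m)) :
    ∃ S : Multiset ℂ, S.card = D ∧ ∀ n, 1 ≤ n → W n = - (S.map (· ^ n)).sum := by
  classical
  let Q : ℂ[X] := ∑ i ∈ range (D + 1), C (c (D - i)) * X ^ i
  have hQc : ∀ i, Q.coeff i = if i ≤ D then c (D - i) else 0 := by
    intro i
    simp only [Q, finsetSum_coeff, coeff_C_mul_X_pow]
    rw [sum_ite_eq]
    simp
  have hQd : Q.natDegree ≤ D := by
    rw [natDegree_le_iff_coeff_eq_zero]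
    intro i hi
    rw [hQc, if_neg (by omega)]
  have hQm : Q.Monic := monic_of_natDegree_le_of_coeff_eq_one D hQd (by rw [hQc]; simp [hc0])
  have hQD : Q.natDegree = D := natDegree_eq_of_le_of_coeff_ne_zero hQd (by rw [hQc]; simp [hc0])
  have hcard : Q.roots.card = Q.natDegree := (IsAlgClosed.splits Q).natDegree_eq_card_roots.symm
  set S := Q.roots with hS
  refine ⟨S, hcard.trans hQD, ?_⟩
  have hce : ∀ n, c n = (-1) ^ n * S.esymm n := by
    intro n
    rcases le_or_gt n D with h | h
    · have := coeff_eq_esymm_roots_of_card hcard (k := D - n) (by omega)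
      rw [hQm.leadingCoeff, hQD, hQc, if_pos (by omega), Nat.sub_sub_self h, one_mul] at this
      exact this
    · rw [hcD n h, Multiset.esymm, Multiset.powersetCard_eq_empty _ (by omega)]
      simp
  have hpsum : ∀ n, MvPolynomial.aeval (fun x : S => (x : ℂ)) (MvPolynomial.psum S ℂ n) =
      (S.map (· ^ n)).sum := by
    intro n
    rw [MvPolynomial.psum, map_sum]
    simp only [map_pow, MvPolynomial.aeval_X]
    have h := congrArg (fun T => (Multiset.map (· ^ n) T).sum) (Multiset.map_univ_coe S)
    simp only [Multiset.map_map] at h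
    exact h
  have hesymm : ∀ n, MvPolynomial.aeval (fun x : S => (x : ℂ)) (MvPolynomial.esymm S ℂ n) =
      S.esymm n := by
    intro n
    rw [MvPolynomial.aeval_esymm_eq_multiset_esymm]
    congr 1
    exact Multiset.map_univ_coe S
  have hnewton : ∀ n : ℕ, (n : ℂ) * c n =
      ∑ m ∈ Icc 1 n, (-(S.map (· ^ m)).sum) * c (n - m) := by
    intro n
    have := congrArg (MvPolynomial.aeval (fun x : S => (x : ℂ)))
      (MvPolynomial.mul_esymm_eq_sum S ℂ n)
    simp only [map_mul, map_sum, map_pow, map_neg, map_one, map_natCast, hpsum, hesymm] at this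
    rw [hce, mul_left_comm, this, ← mul_assoc, mul_sum]
    have hsq : ((-1 : ℂ)) ^ n * (-1) ^ (n + 1) = -1 := by
      rw [← pow_add, Odd.neg_one_pow ⟨n, by ring⟩]
    rw [hsq]
    refine sum_bij' (fun x _ => x.2) (fun m _ => (n - m, m)) ?_ ?_ ?_ ?_ ?_
    · rintro ⟨i, j⟩ h
      simp only [mem_filter, HasAntidiagonal.mem_antidiagonal, mem_Icc] at h ⊢
      omega
    · intro m h
      simp only [mem_filter, HasAntidiagonal.mem_antidiagonal, mem_Icc] at h ⊢
      omega
    · rintro ⟨i, j⟩ h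
      simp only [mem_filter, HasAntidiagonal.mem_antidiagonal] at h
      simp only [Prod.mk.injEq, and_true]
      omega
    · intro m h
      rfl
    · rintro ⟨i, j⟩ h
      simp only [mem_filter, HasAntidiagonal.mem_antidiagonal] at h
      rw [← h.1, Nat.add_sub_cancel, hce]
      ring
  intro n
  induction n using Nat.strong_induction_on with
  | _ n ih =>
    intro hn
    have h := (hrec n).symm.trans (hnewton n)
    rw [← sum_erase_add _ _ (right_mem_Icc.2 hn), ← sum_erase_add _ _ (right_mem_Icc.2 hn)] at h
    have h2 : ∑ m ∈ (Icc 1 n).erase n, W m * c (n - m) =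
        ∑ m ∈ (Icc 1 n).erase n, (-(S.map (· ^ m)).sum) * c (n - m) := by
      refine sum_congr rfl fun m hm => ?_
      obtain ⟨h1, h2⟩ := mem_erase.1 hm
      rw [mem_Icc] at h2
      rw [ih m (by omega) h2.1]
    rw [h2] at h
    simpa [hc0] using h

/-- If the even power sums of finitely many complex numbers are `O(q ^ s)`, then all the numbers
are at most `√q` in absolute value. -/
theorem norm_sq_le_of_norm_powerSums_le (S : Multiset ℂ) (C q : ℝ) (hq : 0 < q)
    (h : ∀ s : ℕ, 1 ≤ s → ‖(S.map (· ^ (2 * s))).sum‖ ≤ C * q ^ s) :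
    ∀ w ∈ S, ‖w‖ ^ 2 ≤ q := by
  classical
  intro w hw
  set Z : Multiset ℂ := S.map (· ^ 2) with hZ
  have hwZ : w ^ 2 ∈ Z := Multiset.mem_map_of_mem _ hw
  have hZs : ∀ s : ℕ, 1 ≤ s → ‖(Z.map (· ^ s)).sum‖ ≤ C * q ^ s := by
    intro s hs
    rw [hZ, Multiset.map_map]
    simpa [← pow_mul, Function.comp_def] using h s hs
  rw [← norm_pow]
  set z := w ^ 2
  let Q : ℂ[X] := ∏ y ∈ Z.toFinset.erase z, (X - Polynomial.C y)
  have hQz : Q.eval z ≠ 0 := by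
    simp only [Q, eval_prod, eval_sub, eval_X, eval_C]
    exact prod_ne_zero_iff.2 fun y hy => sub_ne_zero.2 (ne_of_mem_erase hy).symm
  have hQy : ∀ y ∈ Z, y ≠ z → Q.eval y = 0 := by
    intro y hy hyz
    simp only [Q, eval_prod, eval_sub, eval_X, eval_C]
    exact prod_eq_zero (mem_erase.2 ⟨hyz, Multiset.mem_toFinset.2 hy⟩) (sub_self y)
  have hkey : ∀ m : ℕ, (Z.map fun y => y ^ m * Q.eval y).sum = Z.count z * (z ^ m * Q.eval z) := by
    intro m
    rw [sum_multiset_map_count, sum_eq_single z]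
    · simp
    · intro y hy hyz
      rw [hQy y (Multiset.mem_toFinset.1 hy) hyz]; simp
    · intro hz
      exact absurd (Multiset.mem_toFinset.2 hwZ) hz
  have hkey2 : ∀ m : ℕ, (Z.map fun y => y ^ m * Q.eval y).sum =
      ∑ k ∈ range (Q.natDegree + 1), Q.coeff k * (Z.map (· ^ (m + k))).sum := by
    intro m
    simp_rw [← Multiset.sum_map_mul_left, eval_eq_sum_range, mul_sum]
    rw [Multiset.sum_map_sum]
    refine sum_congr rfl fun k _ => congrArg _ (Multiset.map_congr rfl fun y _ => ?_)
    rw [pow_add]; ring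
  have hcount : 1 ≤ (Z.count z : ℝ) := by
    exact_mod_cast Multiset.one_le_count_iff_mem.2 hwZ
  set B : ℝ := ∑ k ∈ range (Q.natDegree + 1), ‖Q.coeff k‖ * (C * q ^ k)
  have hbound : ∀ m : ℕ, 1 ≤ m → ‖z‖ ^ m * ‖Q.eval z‖ ≤ B * q ^ m := by
    intro m hm
    calc ‖z‖ ^ m * ‖Q.eval z‖ ≤ Z.count z * (‖z‖ ^ m * ‖Q.eval z‖) :=
          le_mul_of_one_le_left (by positivity) hcount
      _ = ‖(Z.map fun y => y ^ m * Q.eval y).sum‖ := by rw [hkey]; simp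
      _ ≤ ∑ k ∈ range (Q.natDegree + 1), ‖Q.coeff k‖ * (C * q ^ (m + k)) := by
          rw [hkey2]
          refine (norm_sum_le _ _).trans (sum_le_sum fun k _ => ?_)
          rw [norm_mul]
          exact mul_le_mul_of_nonneg_left (hZs _ (by omega)) (norm_nonneg _)
      _ = B * q ^ m := by
          rw [sum_mul]
          refine sum_congr rfl fun k _ => ?_
          rw [pow_add]; ring
  by_contra! hlt
  have h1 : 1 < ‖z‖ / q := (one_lt_div hq).2 hlt
  obtain ⟨m, hm⟩ := pow_unbounded_of_one_lt (B / ‖Q.eval z‖) h1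
  have hm' : B / ‖Q.eval z‖ < (‖z‖ / q) ^ (m + 1) :=
    hm.trans_le (pow_le_pow_right₀ h1.le (Nat.le_succ m))
  have h3 := hbound (m + 1) (by omega)
  rw [div_pow, div_lt_div_iff₀ (norm_pos_iff.2 hQz) (by positivity)] at hm'
  linarith

theorem sum_divisors_monicIrreds_evalCharHom {F E : Type*} [Field F] [Finite F] [Field E]
    [Fintype E] [Algebra F E] (χ : MulChar F ℂ) (A : Finset F) (m : ℕ)
    (hE : Module.finrank F E = m) :
    ∑ d ∈ m.divisors, ∑ P ∈ monicIrreds F d, (d : ℂ) * evalCharHom χ A P ^ (m / d) =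
      ∑ x : E, ∏ a ∈ A, χ (Algebra.norm F (algebraMap F E a - x)) := by
  have h := sum_minpoly_eq (E := E) m hE fun P => evalCharHom χ A P ^ (m / P.natDegree)
  have h2 : ∑ d ∈ m.divisors, ∑ P ∈ monicIrreds F d,
      (d : ℂ) * evalCharHom χ A P ^ (m / P.natDegree) =
      ∑ d ∈ m.divisors, ∑ P ∈ monicIrreds F d, (d : ℂ) * evalCharHom χ A P ^ (m / d) :=
    sum_congr rfl fun d _ => sum_congr rfl fun P hP => by rw [(mem_monicIrreds.1 hP).1.2]
  rw [← h2, ← h]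
  refine sum_congr rfl fun x _ => ?_
  rw [evalCharHom_apply, ← prod_pow]
  refine prod_congr rfl fun a _ => ?_
  rw [norm_algebraMap_sub_eq_eval_minpoly, hE, map_pow]

/-- **Weil's bound** for character sums of products of distinct linear factors. -/
theorem norm_sum_prod_mulChar_sub_le (p : ℕ) [Fact p.Prime] (A : Finset (ZMod p))
    (hA : A.Nonempty) (χ : MulChar (ZMod p) ℂ) (hχ : χ ≠ 1) :
    ‖∑ x : ZMod p, ∏ a ∈ A, χ (a - x)‖ ≤ A.card * √p := by
  have hp : 0 < (p : ℝ) := by exact_mod_cast (Fact.out : p.Prime).pos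
  let c : ℕ → ℂ := fun n => ∑ g ∈ monicPolys (ZMod p) n, evalCharHom χ A g
  let W : ℕ → ℂ := fun m => ∑ d ∈ m.divisors, ∑ P ∈ monicIrreds (ZMod p) d,
    (d : ℂ) * evalCharHom χ A P ^ (m / d)
  have hc0 : c 0 = 1 := by
    have : monicPolys (ZMod p) 0 = {1} := by
      ext g
      rw [mem_monicPolys, mem_singleton]
      exact ⟨fun h => h.1.natDegree_eq_zero.1 h.2, by rintro rfl; simp⟩
    simp [c, this]
  obtain ⟨S, hS, hW⟩ := exists_powerSums c W (A.card - 1) hc0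
    (fun n hn => sum_monicPolys_evalCharHom_eq_zero χ hχ A hA n (by omega))
    (fun n => mul_sum_monicPolys (evalCharHom χ A) n)
  obtain ⟨C, hC⟩ := exists_norm_sum_extension_le p A hA χ hχ
  have hroots : ∀ w ∈ S, ‖w‖ ^ 2 ≤ p := by
    refine norm_sq_le_of_norm_powerSums_le S C p hp fun s hs => ?_
    have : Fintype (GaloisField p (2 * s)) := Fintype.ofFinite _
    have hfr : Module.finrank (ZMod p) (GaloisField p (2 * s)) = 2 * s :=
      GaloisField.finrank p (by omega)
    have h := hC s (GaloisField p (2 * s)) hs (by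
      rw [← Nat.card_eq_fintype_card, GaloisField.card p _ (by omega)])
    rw [← sum_divisors_monicIrreds_evalCharHom χ A _ hfr] at h
    have h2 := hW (2 * s) (by omega)
    simp only [W] at h2
    rwa [h2, norm_neg] at h
  have h1 := hW 1 le_rfl
  simp only [W] at h1
  rw [sum_divisors_monicIrreds_evalCharHom (E := ZMod p) χ A 1 (Module.finrank_self _)] at h1
  simp only [Algebra.algebraMap_self, RingHom.id_apply, Algebra.norm_self, MonoidHom.id_apply, pow_one,
    Multiset.map_id'] at h1
  rw [h1, norm_neg]
  have hle : ∀ w ∈ S, ‖w‖ ≤ √p := fun w hw => Real.le_sqrt_of_sq_le (hroots w hw)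
  calc ‖S.sum‖ ≤ (S.map (‖·‖)).sum := norm_multiset_sum_le S
    _ ≤ (S.map (‖·‖)).card • √p := Multiset.sum_le_card_nsmul _ _ (by simpa using hle)
    _ ≤ A.card * √p := by
      rw [Multiset.card_map, hS, nsmul_eq_mul]
      have : ((A.card - 1 : ℕ) : ℝ) ≤ A.card := by exact_mod_cast Nat.sub_le _ _
      gcongr

theorem norm_sum_range_shift_sub_le (f : ℕ → ℂ) (hf : ∀ n, ‖f n‖ ≤ 1) (N k : ℕ) :
    ‖∑ n ∈ range N, f n - ∑ n ∈ range N, f (n + k)‖ ≤ 2 * k := by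
  have h1 : ∑ n ∈ range N, f n + ∑ j ∈ range k, f (N + j) =
      ∑ j ∈ range k, f j + ∑ n ∈ range N, f (n + k) := by
    rw [← sum_range_add, add_comm N k, sum_range_add]
    simp_rw [add_comm k]
  have h2 : ∑ n ∈ range N, f n - ∑ n ∈ range N, f (n + k) =
      ∑ j ∈ range k, f j - ∑ j ∈ range k, f (N + j) := by linear_combination h1
  have h3 : ∀ g : ℕ → ℂ, (∀ n, ‖g n‖ ≤ 1) → ‖∑ j ∈ range k, g j‖ ≤ k := fun g hg => by
    simpa using norm_sum_le_of_le (range k) fun j _ => hg j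
  rw [h2]
  have h4 := norm_sub_le (∑ j ∈ range k, f j) (∑ j ∈ range k, f (N + j))
  linarith [h3 f hf, h3 (fun j => f (N + j)) fun j => hf _]

/-- Replacing a sum by an average of short shifted sums. -/
theorem mul_norm_sum_range_le (f : ℕ → ℂ) (hf : ∀ n, ‖f n‖ ≤ 1) (N K : ℕ) :
    K * ‖∑ n ∈ range N, f n‖ ≤
      ∑ n ∈ range N, ‖∑ k ∈ range K, f (n + k)‖ + (K : ℝ) ^ 2 := by
  have h1 : (K : ℂ) * ∑ n ∈ range N, f n = ∑ n ∈ range N, ∑ k ∈ range K, f (n + k) +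
      ∑ k ∈ range K, (∑ n ∈ range N, f n - ∑ n ∈ range N, f (n + k)) := by
    rw [sum_comm, sum_sub_distrib]
    simp
  have h2 : ‖(K : ℂ) * ∑ n ∈ range N, f n‖ = K * ‖∑ n ∈ range N, f n‖ := by simp
  rw [← h2, h1]
  refine (norm_add_le _ _).trans (add_le_add (norm_sum_le _ _) ?_)
  refine (norm_sum_le_of_le _ fun k _ => norm_sum_range_shift_sub_le f hf N k).trans ?_
  rw [← mul_sum]
  have h3 := Nat.cast_sum (range K) (fun i => i) (R := ℝ)
  have h4 := Finset.sum_range_id_mul_two K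
  have h5 : (∑ i ∈ range K, i) * 2 ≤ K ^ 2 := by
    rw [h4, sq]; exact Nat.mul_le_mul_left _ (Nat.sub_le _ _)
  rw [← h3, mul_comm]
  exact_mod_cast h5

theorem sum_norm_sq_le_sum_norm_correlation {ι : Type*} (X : Finset ι) (K : ℕ)
    (z : ℕ → ι → ℂ) :
    ∑ x ∈ X, ‖∑ k ∈ range K, z k x‖ ^ 2 ≤
      ∑ k ∈ range K, ∑ l ∈ range K, ‖∑ x ∈ X, z k x * starRingEnd ℂ (z l x)‖ := by
  have h1 : ((∑ x ∈ X, ‖∑ k ∈ range K, z k x‖ ^ 2 : ℝ) : ℂ) =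
      ∑ k ∈ range K, ∑ l ∈ range K, ∑ x ∈ X, z k x * starRingEnd ℂ (z l x) := by
    push_cast
    simp_rw [← Complex.mul_conj', map_sum, sum_mul_sum]
    rw [sum_comm]
    exact sum_congr rfl fun k _ => sum_comm
  have h2 : ∑ x ∈ X, ‖∑ k ∈ range K, z k x‖ ^ 2 =
      ‖((∑ x ∈ X, ‖∑ k ∈ range K, z k x‖ ^ 2 : ℝ) : ℂ)‖ := by
    rw [Complex.norm_real, Real.norm_of_nonneg (by positivity)]
  rw [h2, h1]
  exact (norm_sum_le _ _).trans (sum_le_sum fun k _ => norm_sum_le _ _)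

section

variable {p : ℕ} [Fact p.Prime]

theorem natCast_factorial_ne_zero {n : ℕ} (hn : n < p) : (n.factorial : ZMod p) ≠ 0 := by
  rw [Ne, ZMod.natCast_eq_zero_iff, (Fact.out : p.Prime).dvd_factorial]
  omega

theorem natCast_factorial_add_eq_mul_prod (n : ℕ) {k l : ℕ} (hkl : k ≤ l) :
    ((n + l + 1).factorial : ZMod p) =
      (n + k + 1).factorial * ∏ i ∈ Ico k l, ((n : ZMod p) + (i + 2 : ℕ)) := by
  induction l, hkl using Nat.le_induction with
  | base => simp
  | succ l hkl ih =>
    rw [prod_Ico_succ_top hkl, ← mul_assoc, ← ih, ← add_assoc, Nat.factorial_succ]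
    push_cast
    ring

omit [Fact p.Prime] in
theorem norm_mulChar_le_one (χ : MulChar (ZMod p) ℂ) (x : ZMod p) : ‖χ x‖ ≤ 1 :=
  DirichletCharacter.norm_le_one χ x

theorem norm_mulChar_eq_one (χ : MulChar (ZMod p) ℂ) {x : ZMod p} (hx : x ≠ 0) : ‖χ x‖ = 1 := by
  simpa using DirichletCharacter.unit_norm_eq_one χ (Units.mk0 x hx)

theorem mulChar_mul_conj (χ : MulChar (ZMod p) ℂ) {x : ZMod p} (hx : x ≠ 0) :
    χ x * starRingEnd ℂ (χ x) = 1 := by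
  rw [Complex.mul_conj', norm_mulChar_eq_one χ hx]
  simp

theorem mulChar_factorial_mul_conj (χ : MulChar (ZMod p) ℂ) {n k l : ℕ} (hkl : k ≤ l)
    (hn : n + l + 1 < p) :
    χ ((n + k + 1).factorial : ZMod p) * starRingEnd ℂ (χ ((n + l + 1).factorial : ZMod p)) =
      starRingEnd ℂ (χ (∏ i ∈ Ico k l, ((n : ZMod p) + (i + 2 : ℕ)))) := by
  rw [natCast_factorial_add_eq_mul_prod n hkl, map_mul, map_mul, ← mul_assoc,
    mulChar_mul_conj χ (natCast_factorial_ne_zero (by omega)), one_mul]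

theorem natCast_add_two_injOn {l : ℕ} (hl : l + 1 < p) (k : ℕ) :
    Set.InjOn (fun i : ℕ => ((i + 2 : ℕ) : ZMod p)) (Ico k l) := by
  intro i hi j hj hij
  simp only [coe_Ico, Set.mem_Ico] at hi hj
  have h := (ZMod.natCast_eq_natCast_iff' _ _ p).1 hij
  rw [Nat.mod_eq_of_lt (by omega), Nat.mod_eq_of_lt (by omega)] at h
  omega

theorem norm_sum_mulChar_prod_add_le (χ : MulChar (ZMod p) ℂ) (hχ : χ ≠ 1) {k l : ℕ}
    (hkl : k < l) (hl : l + 1 < p) :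
    ‖∑ x : ZMod p, χ (∏ i ∈ Ico k l, (x + (i + 2 : ℕ)))‖ ≤ l * √p := by
  have hinj := natCast_add_two_injOn (p := p) hl k
  have h := norm_sum_prod_mulChar_sub_le p ((Ico k l).image fun i : ℕ => ((i + 2 : ℕ) : ZMod p))
    ((nonempty_Ico.2 hkl).image _) χ hχ
  simp_rw [prod_image hinj] at h
  rw [card_image_of_injOn hinj, Nat.card_Ico] at h
  have h2 : ∑ x : ZMod p, χ (∏ i ∈ Ico k l, (x + (i + 2 : ℕ))) =
      ∑ x : ZMod p, ∏ i ∈ Ico k l, χ ((i + 2 : ℕ) - x) := by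
    rw [← Equiv.sum_comp (Equiv.neg (ZMod p))]
    refine sum_congr rfl fun x _ => ?_
    rw [map_prod]
    refine prod_congr rfl fun i _ => ?_
    rw [Equiv.neg_apply, neg_add_eq_sub]
  rw [h2]
  refine h.trans ?_
  have : ((l - k : ℕ) : ℝ) ≤ l := by exact_mod_cast Nat.sub_le _ _
  gcongr

/-- Correlations of the characters of two products of consecutive linear factors. -/
theorem norm_sum_mulChar_mul_conj_le (χ : MulChar (ZMod p) ℂ) (hχ : χ ≠ 1) {k l : ℕ}
    (hkl : k < l) (hl : l + 1 < p) :
    ‖∑ x : ZMod p, χ (∏ i ∈ Ico 0 k, (x + (i + 2 : ℕ))) *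
      starRingEnd ℂ (χ (∏ i ∈ Ico 0 l, (x + (i + 2 : ℕ))))‖ ≤ l * √p + k := by
  classical
  set Q : ℕ → ℕ → ZMod p → ZMod p := fun a b x => ∏ i ∈ Ico a b, (x + (i + 2 : ℕ)) with hQ
  have hsplit : ∀ x, Q 0 l x = Q 0 k x * Q k l x := fun x =>
    (prod_Ico_consecutive _ (Nat.zero_le k) hkl.le).symm
  have hterm : ∀ x, ‖χ (Q 0 k x) * starRingEnd ℂ (χ (Q 0 l x)) - starRingEnd ℂ (χ (Q k l x))‖ ≤
      if Q 0 k x = 0 then 1 else 0 := by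
    intro x
    split_ifs with h
    · rw [h, MulChar.map_zero, zero_mul, zero_sub, norm_neg, RCLike.norm_conj]
      exact norm_mulChar_le_one χ _
    · rw [hsplit, map_mul, map_mul, ← mul_assoc, mulChar_mul_conj χ h]
      simp
  have hcard : (univ.filter fun x => Q 0 k x = 0).card ≤ k := by
    have hsub : (univ.filter fun x => Q 0 k x = 0) ⊆
        (Ico 0 k).image fun i : ℕ => -((i + 2 : ℕ) : ZMod p) := by
      intro x hx
      obtain ⟨i, hi, h0⟩ := prod_eq_zero_iff.1 (mem_filter.1 hx).2
      exact mem_image.2 ⟨i, hi, (eq_neg_of_add_eq_zero_left h0).symm⟩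
    simpa using (card_le_card hsub).trans card_image_le
  have hdiff : ‖∑ x, χ (Q 0 k x) * starRingEnd ℂ (χ (Q 0 l x)) -
      ∑ x, starRingEnd ℂ (χ (Q k l x))‖ ≤ k := by
    rw [← sum_sub_distrib]
    refine (norm_sum_le_of_le _ fun x _ => hterm x).trans ?_
    rw [sum_boole]
    exact_mod_cast hcard
  have hmain : ‖∑ x, starRingEnd ℂ (χ (Q k l x))‖ ≤ l * √p := by
    rw [← map_sum, RCLike.norm_conj]
    exact norm_sum_mulChar_prod_add_le χ hχ hkl hl
  have := norm_le_norm_add_norm_sub' (∑ x, χ (Q 0 k x) * starRingEnd ℂ (χ (Q 0 l x)))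
    (∑ x, starRingEnd ℂ (χ (Q k l x)))
  linarith

theorem sum_norm_sq_sum_mulChar_prod_le (χ : MulChar (ZMod p) ℂ) (hχ : χ ≠ 1) {K : ℕ}
    (hK : K + 1 < p) :
    ∑ x : ZMod p, ‖∑ k ∈ range K, χ (∏ i ∈ Ico 0 k, (x + (i + 2 : ℕ)))‖ ^ 2 ≤
      p * K + 2 * K ^ 3 * √p := by
  have h1p : 1 ≤ √(p : ℝ) := by
    rw [Real.one_le_sqrt]
    exact_mod_cast (Fact.out : p.Prime).one_lt.le
  refine (sum_norm_sq_le_sum_norm_correlation univ K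
    fun k x => χ (∏ i ∈ Ico 0 k, (x + (i + 2 : ℕ)))).trans ?_
  have hbd : ∀ k ∈ range K, ∀ l ∈ range K,
      ‖∑ x : ZMod p, χ (∏ i ∈ Ico 0 k, (x + (i + 2 : ℕ))) *
        starRingEnd ℂ (χ (∏ i ∈ Ico 0 l, (x + (i + 2 : ℕ))))‖ ≤
      (if k = l then (p : ℝ) else 0) + 2 * K * √p := by
    intro k hk l hl
    rw [mem_range] at hk hl
    have hgen : ∀ a b : ℕ, a ≤ K → b ≤ K → (b : ℝ) * √p + a ≤ 2 * K * √p := by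
      intro a b ha hb
      have ha' : (a : ℝ) ≤ K := by exact_mod_cast ha
      have hb' : (b : ℝ) ≤ K := by exact_mod_cast hb
      nlinarith
    rcases lt_trichotomy k l with h | rfl | h
    · rw [if_neg h.ne, zero_add]
      exact (norm_sum_mulChar_mul_conj_le χ hχ h (by omega)).trans (hgen _ _ hk.le hl.le)
    · rw [if_pos rfl]
      have : ‖∑ x : ZMod p, χ (∏ i ∈ Ico 0 k, (x + (i + 2 : ℕ))) *
        starRingEnd ℂ (χ (∏ i ∈ Ico 0 k, (x + (i + 2 : ℕ))))‖ ≤ p := by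
        refine (norm_sum_le_of_le (f := fun x : ZMod p => χ (∏ i ∈ Ico 0 k, (x + (i + 2 : ℕ))) *
          starRingEnd ℂ (χ (∏ i ∈ Ico 0 k, (x + (i + 2 : ℕ))))) univ
          (n := fun _ => (1 : ℝ)) fun x _ => ?_).trans ?_
        · rw [norm_mul, RCLike.norm_conj]
          exact mul_le_one₀ (norm_mulChar_le_one χ _) (norm_nonneg _) (norm_mulChar_le_one χ _)
        · simp [ZMod.card]
      have h0 : 0 ≤ 2 * (K : ℝ) * √p := by positivity
      linarith
    · rw [if_neg h.ne', zero_add, ← RCLike.norm_conj, map_sum]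
      simp_rw [map_mul, RCLike.conj_conj]
      simp_rw [mul_comm (starRingEnd ℂ _)]
      exact (norm_sum_mulChar_mul_conj_le χ hχ h (by omega)).trans (hgen _ _ hl.le hk.le)
  refine (sum_le_sum fun k hk => sum_le_sum fun l hl => hbd k hk l hl).trans ?_
  simp_rw [sum_add_distrib, sum_ite_eq]
  rw [sum_congr rfl (g := fun _ => (p : ℝ)) (fun k hk => by rw [if_pos hk])]
  simp only [sum_const, card_range, nsmul_eq_mul]
  apply le_of_eq
  ring

theorem sum_norm_sq_sum_factorial_le (χ : MulChar (ZMod p) ℂ) (hχ : χ ≠ 1) {N K : ℕ}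
    (hK : N + K + 1 < p) :
    ∑ n ∈ range N, ‖∑ k ∈ range K, χ ((n + k + 1).factorial : ZMod p)‖ ^ 2 ≤
      p * K + 2 * K ^ 3 * √p := by
  refine le_trans ?_ (sum_norm_sq_sum_mulChar_prod_le χ hχ (by omega))
  have hterm : ∀ n ∈ range N, ‖∑ k ∈ range K, χ ((n + k + 1).factorial : ZMod p)‖ ^ 2 =
      ‖∑ k ∈ range K, χ (∏ i ∈ Ico 0 k, ((n : ZMod p) + (i + 2 : ℕ)))‖ ^ 2 := by
    intro n hn
    rw [mem_range] at hn
    simp_rw [natCast_factorial_add_eq_mul_prod (p := p) n (Nat.zero_le _), map_mul]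
    rw [← mul_sum, norm_mul, norm_mulChar_eq_one χ (natCast_factorial_ne_zero (by omega)), one_mul]
  rw [sum_congr rfl hterm]
  have hinj : Set.InjOn (fun n : ℕ => (n : ZMod p)) (range N) := by
    intro i hi j hj hij
    simp only [coe_range, Set.mem_Iio] at hi hj
    have h := (ZMod.natCast_eq_natCast_iff' _ _ p).1 hij
    rwa [Nat.mod_eq_of_lt (by omega), Nat.mod_eq_of_lt (by omega)] at h
  rw [← sum_image (f := fun x : ZMod p =>
    ‖∑ k ∈ range K, χ (∏ i ∈ Ico 0 k, (x + (i + 2 : ℕ)))‖ ^ 2) hinj]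
  exact sum_le_sum_of_subset_of_nonneg (subset_univ _) fun _ _ _ => by positivity

end

section

variable {p : ℕ} [Fact p.Prime]

/-- A Weil-type bound for an individual character sum over factorials. -/
theorem norm_sum_mulChar_factorial_le (χ : MulChar (ZMod p) ℂ) (hχ : χ ≠ 1) {N : ℕ} (hN : 1 ≤ N)
    (q : ℝ) (hq : 1 ≤ q) (hqp : q ^ 4 = p) (hNp : N + q + 1 < p) :
    ‖∑ n ∈ range N, χ ((n + 1).factorial : ZMod p)‖ ≤ 4 * √(N * q ^ 3) := by
  set K := ⌊q⌋₊ with hK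
  have hKq : (K : ℝ) ≤ q := Nat.floor_le (by linarith)
  have hK1 : 1 ≤ K := Nat.one_le_floor_iff _ |>.2 hq
  have hK1' : (1 : ℝ) ≤ K := by exact_mod_cast hK1
  have hqK : q ≤ 2 * K := by linarith [Nat.lt_floor_add_one q]
  have hKp : N + K + 1 < p := by
    have : (N : ℝ) + K + 1 < p := by linarith
    exact_mod_cast this
  have hsqrt : √(p : ℝ) = q ^ 2 := by
    rw [← hqp, show q ^ 4 = (q ^ 2) ^ 2 by ring, Real.sqrt_sq (by positivity)]
  have h1 := sum_norm_sq_sum_factorial_le χ hχ hKp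
  have h2 := mul_norm_sum_range_le (fun n => χ ((n + 1).factorial : ZMod p))
    (fun n => norm_mulChar_le_one χ _) N K
  have h3 := sq_sum_le_card_mul_sum_sq (s := range N)
    (f := fun n => ‖∑ k ∈ range K, χ ((n + k + 1).factorial : ZMod p)‖)
  rw [card_range] at h3
  rw [hsqrt, ← hqp] at h1
  set V := ∑ n ∈ range N, ‖∑ k ∈ range K, χ ((n + k + 1).factorial : ZMod p)‖
  set s := ‖∑ n ∈ range N, χ ((n + 1).factorial : ZMod p)‖
  have hN' : (1 : ℝ) ≤ N := by exact_mod_cast hN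
  set r := √(N * q ^ 3) with hr
  have hr2 : r ^ 2 = N * q ^ 3 := Real.sq_sqrt (by positivity)
  have hr0 : 0 ≤ r := Real.sqrt_nonneg _
  have h4 : q ^ 4 * K + 2 * K ^ 3 * q ^ 2 ≤ 3 * (q ^ 4 * K) := by
    have : (K : ℝ) ^ 2 ≤ q ^ 2 := by gcongr
    have h5 : (K : ℝ) * q ^ 2 * K ^ 2 ≤ K * q ^ 2 * q ^ 2 := by gcongr
    nlinarith
  have h5 : q ^ 4 * K ≤ 2 * (q ^ 3 * K ^ 2) := by
    have : q ^ 3 * K * q ≤ q ^ 3 * K * (2 * K) := by gcongr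
    nlinarith
  have hV : V ≤ 3 * r * K := by
    refine (sq_le_sq₀ (sum_nonneg fun _ _ => norm_nonneg _) (by positivity)).1 ?_
    calc V ^ 2 ≤ N * (q ^ 4 * K + 2 * K ^ 3 * q ^ 2) := h3.trans (by gcongr)
      _ ≤ N * (6 * (q ^ 3 * K ^ 2)) := by gcongr; linarith
      _ = 6 * r ^ 2 * K ^ 2 := by rw [hr2]; ring
      _ ≤ (3 * r * K) ^ 2 := by nlinarith [sq_nonneg (r * K)]
  have hKr : (K : ℝ) ≤ r := by
    refine hKq.trans (Real.le_sqrt_of_sq_le ?_)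
    calc q ^ 2 ≤ 1 * q ^ 3 := by rw [one_mul]; exact pow_le_pow_right₀ hq (by norm_num)
      _ ≤ N * q ^ 3 := by gcongr
  have h6 : K * s ≤ K * (3 * r + K) := by linarith
  have h7 := le_of_mul_le_mul_left h6 (by linarith)
  linarith

theorem conj_mulChar (χ : MulChar (ZMod p) ℂ) (x : ZMod p) :
    starRingEnd ℂ (χ x) = χ x⁻¹ := by
  rw [← MulChar.inv_apply', ← MulChar.star_eq_inv]
  rfl

/-- Mean square of a character sum over all characters. -/
theorem sum_norm_sq_sum_mulChar_eq {ι : Type*} (X : Finset ι) (g : ι → ZMod p)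
    (hg : ∀ x ∈ X, g x ≠ 0) :
    ∑ χ : DirichletCharacter ℂ p, ‖∑ x ∈ X, χ (g x)‖ ^ 2 =
      (p - 1 : ℕ) * ∑ y ∈ X, ((X.filter fun x => g x = g y).card : ℝ) := by
  classical
  have h1 : ((∑ χ : DirichletCharacter ℂ p, ‖∑ x ∈ X, χ (g x)‖ ^ 2 : ℝ) : ℂ) =
      (p - 1 : ℕ) * ∑ y ∈ X, ((X.filter fun x => g x = g y).card : ℂ) := by
    push_cast
    simp_rw [← Complex.mul_conj', map_sum, sum_mul_sum, conj_mulChar]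
    rw [sum_comm, mul_sum]
    refine (sum_congr rfl fun x _ => sum_comm).trans (sum_comm.trans ?_)
    refine sum_congr rfl fun y hy => ?_
    rw [← sum_boole, mul_sum]
    refine sum_congr rfl fun x hx => ?_
    have := DirichletCharacter.sum_char_inv_mul_char_eq ℂ (hg y hy).isUnit (g x)
    rw [sum_congr rfl fun χ _ => mul_comm (χ (g x)) (χ (g y)⁻¹), this, Nat.totient_prime Fact.out]
    simp only [eq_comm (a := g x)]
    split_ifs <;> simp
  exact_mod_cast h1

theorem card_filter_prod_add_eq_le (N : ℕ) (hN : N ≤ p) {k l : ℕ} (hkl : k < l) (b : ZMod p) :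
    ((range N).filter fun n : ℕ =>
      ∏ i ∈ Ico k l, ((n : ZMod p) + (i + 2 : ℕ)) = b).card ≤ l := by
  classical
  let f : (ZMod p)[X] := ∏ i ∈ Ico k l, (X + C ((i + 2 : ℕ) : ZMod p))
  have hfm : f.Monic := monic_prod_of_monic _ _ fun i _ => monic_X_add_C _
  have hfd : f.natDegree = l - k := by
    simp only [f]
    rw [natDegree_prod_of_monic _ _ fun i _ => monic_X_add_C _]
    simp only [natDegree_X_add_C, sum_const, Nat.card_Ico, smul_eq_mul, mul_one]
  have hlt : (C b : (ZMod p)[X]).degree < f.degree := by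
    rw [degree_eq_natDegree hfm.ne_zero, hfd]
    refine degree_C_le.trans_lt ?_
    exact_mod_cast Nat.sub_pos_of_lt hkl
  have hm : (f - C b).Monic := hfm.sub_of_left hlt
  have hd : (f - C b).natDegree = l - k := by
    rw [natDegree_sub_C, hfd]
  have hinj : Set.InjOn (fun n : ℕ => (n : ZMod p)) (range N) :=
    (CharP.natCast_injOn_Iio (ZMod p) p).mono fun n hn => by
      simp only [coe_range, Set.mem_Iio] at hn ⊢
      omega
  calc _ = (((range N).filter fun n : ℕ =>
        ∏ i ∈ Ico k l, ((n : ZMod p) + (i + 2 : ℕ)) = b).image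
          fun n : ℕ => (n : ZMod p)).card :=
        (card_image_of_injOn (hinj.mono (filter_subset _ _))).symm
    _ ≤ (f - C b).roots.toFinset.card := by
        refine card_le_card fun x hx => ?_
        obtain ⟨n, hn, rfl⟩ := mem_image.1 hx
        rw [Multiset.mem_toFinset, mem_roots hm.ne_zero, IsRoot.def, eval_sub, eval_C,
          sub_eq_zero]
        simpa [f, eval_prod] using (mem_filter.1 hn).2
    _ ≤ l := ((Multiset.toFinset_card_le _).trans (card_roots' _)).trans (by omega)

theorem sum_norm_sq_correlation_le {N k l : ℕ} (hkl : k < l) (hN : N + l < p) :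
    ∑ χ : DirichletCharacter ℂ p, ‖∑ n ∈ range N, χ ((n + k + 1).factorial : ZMod p) *
      starRingEnd ℂ (χ ((n + l + 1).factorial : ZMod p))‖ ^ 2 ≤ (p : ℝ) * N * l := by
  have h1 : ∀ χ : DirichletCharacter ℂ p, ‖∑ n ∈ range N, χ ((n + k + 1).factorial : ZMod p) *
      starRingEnd ℂ (χ ((n + l + 1).factorial : ZMod p))‖ =
      ‖∑ n ∈ range N, χ (∏ i ∈ Ico k l, ((n : ZMod p) + (i + 2 : ℕ)))‖ := by
    intro χ
    rw [← RCLike.norm_conj (∑ n ∈ range N, χ (∏ i ∈ Ico k l, ((n : ZMod p) + (i + 2 : ℕ)))),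
      map_sum]
    congr 1
    refine sum_congr rfl fun n hn => ?_
    rw [mem_range] at hn
    exact mulChar_factorial_mul_conj χ hkl.le (by omega)
  simp_rw [h1]
  rw [sum_norm_sq_sum_mulChar_eq]
  · calc _ ≤ (p : ℝ) * ∑ y ∈ range N, (l : ℝ) := by
          gcongr with y hy
          · exact_mod_cast Nat.sub_le _ _
          · exact card_filter_prod_add_eq_le N (by omega) hkl _
      _ = p * N * l := by simp; ring
  · intro n hn h0
    rw [mem_range] at hn
    have := natCast_factorial_add_eq_mul_prod (p := p) n hkl.le
    rw [h0, mul_zero] at this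
    exact natCast_factorial_ne_zero (by omega) this

end

theorem sum_range_sum_range_le_of_symm (W : ℕ → ℕ → ℝ) (hW : ∀ k l, W k l = W l k) (M : ℝ)
    (hM : ∀ k, W k k ≤ M) (K : ℕ) :
    ∑ k ∈ range K, ∑ l ∈ range K, W k l ≤ K * M + 2 * ∑ l ∈ range K, ∑ k ∈ range l, W k l := by
  induction K with
  | zero => simp
  | succ K ih =>
    rw [sum_range_succ, sum_range_succ, sum_range_succ (fun l => ∑ k ∈ range l, W k l)]
    simp_rw [sum_range_succ (fun l => W _ l), sum_add_distrib]
    have : ∑ l ∈ range K, W K l = ∑ l ∈ range K, W l K := sum_congr rfl fun l _ => hW _ _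
    push_cast
    linarith [hM K]

/-- A large sum forces its correlations to be large on average. -/
theorem norm_sum_pow_six_le (f : ℕ → ℂ) (hf : ∀ n, ‖f n‖ ≤ 1) (N : ℕ)
    (hs : 18 * (N : ℝ) ^ 2 ≤ ‖∑ n ∈ range N, f n‖ ^ 3) :
    ‖∑ n ∈ range N, f n‖ ^ 6 ≤ 1152 * (N : ℝ) ^ 4 * ∑ l ∈ range N, ∑ k ∈ range l,
      ‖∑ n ∈ range N, f (n + k) * starRingEnd ℂ (f (n + l))‖ ^ 2 / (l : ℝ) ^ 3 := by
  rcases Nat.eq_zero_or_pos N with rfl | hN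
  · simp
  have hN' : (1 : ℝ) ≤ N := by exact_mod_cast hN
  set s := ‖∑ n ∈ range N, f n‖ with hsdef
  have hs0 : 0 < s := by
    have h0 : 0 ≤ s := norm_nonneg _
    rcases h0.eq_or_lt with h | h
    · rw [← h] at hs; nlinarith
    · exact h
  have hsN : s ≤ N := by simpa using norm_sum_le_of_le (range N) fun j _ => hf j
  set K := ⌈8 * (N : ℝ) ^ 2 / s ^ 2⌉₊ with hK
  have hKlow : 8 * (N : ℝ) ^ 2 ≤ K * s ^ 2 := by
    rw [← div_le_iff₀ (by positivity)]
    exact Nat.le_ceil _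
  have hKup : K * s ^ 2 ≤ 9 * (N : ℝ) ^ 2 := by
    have h1 := (Nat.ceil_lt_add_one (show 0 ≤ 8 * (N : ℝ) ^ 2 / s ^ 2 by positivity)).le
    rw [← hK] at h1
    have h2 : (K : ℝ) * s ^ 2 ≤ (8 * (N : ℝ) ^ 2 / s ^ 2 + 1) * s ^ 2 := by gcongr
    rw [add_mul, div_mul_cancel₀ _ (by positivity), one_mul] at h2
    have h3 : s ^ 2 ≤ (N : ℝ) ^ 2 := by gcongr
    linarith
  have hKs : (K : ℝ) ≤ s / 2 := by
    have : (K : ℝ) * s ^ 2 ≤ s / 2 * s ^ 2 := by nlinarith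
    exact le_of_mul_le_mul_right this (by positivity)
  have hKN : K ≤ N := by
    have : (K : ℝ) ≤ N := by linarith
    exact_mod_cast this
  have hK0 : 0 < (K : ℝ) := by
    by_contra! h
    nlinarith [sq_nonneg s]
  set W : ℕ → ℕ → ℝ := fun k l => ‖∑ n ∈ range N, f (n + k) * starRingEnd ℂ (f (n + l))‖ with hWdef
  have hWsymm : ∀ k l, W k l = W l k := by
    intro k l
    simp only [hWdef]
    rw [← RCLike.norm_conj, map_sum]
    simp_rw [map_mul, RCLike.conj_conj, mul_comm (starRingEnd ℂ _)]
  have hWdiag : ∀ k, W k k ≤ N := by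
    intro k
    have : ∀ n ∈ range N, ‖f (n + k) * starRingEnd ℂ (f (n + k))‖ ≤ 1 := fun n _ => by
      rw [norm_mul, RCLike.norm_conj]
      exact mul_le_one₀ (hf _) (norm_nonneg _) (hf _)
    simpa using norm_sum_le_of_le _ this
  set T := ∑ l ∈ range K, ∑ k ∈ range l, W k l with hT
  set E := ∑ l ∈ range K, ∑ k ∈ range l, W k l ^ 2 with hE
  have hTE : T ^ 2 ≤ (K : ℝ) ^ 2 / 2 * E := by
    have h := sq_sum_le_card_mul_sum_sq (s := (range K).sigma fun l => range l)
      (f := fun x => W x.2 x.1)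
    rw [sum_sigma, sum_sigma, card_sigma] at h
    simp only [card_range] at h
    refine h.trans ?_
    have hE0 : 0 ≤ E := sum_nonneg fun _ _ => sum_nonneg fun _ _ => sq_nonneg _
    have hc : ((∑ l ∈ range K, l : ℕ) : ℝ) ≤ (K : ℝ) ^ 2 / 2 := by
      rw [le_div_iff₀ (by norm_num)]
      have h4 := Finset.sum_range_id_mul_two K
      have h5 : (∑ i ∈ range K, i) * 2 ≤ K ^ 2 := by
        rw [h4, sq]; exact Nat.mul_le_mul_left _ (Nat.sub_le _ _)
      exact_mod_cast h5
    exact mul_le_mul_of_nonneg_right hc hE0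
  have hT0 : 0 ≤ T := sum_nonneg fun _ _ => sum_nonneg fun _ _ => norm_nonneg _
  have h1 := mul_norm_sum_range_le f hf N K
  have h2 := sq_sum_le_card_mul_sum_sq (s := range N) (f := fun n => ‖∑ k ∈ range K, f (n + k)‖)
  have h3 := (sum_norm_sq_le_sum_norm_correlation (range N) K fun k n => f (n + k)).trans
    (sum_range_sum_range_le_of_symm W hWsymm N hWdiag K)
  rw [card_range] at h2
  rw [← hsdef] at h1
  set V := ∑ n ∈ range N, ‖∑ k ∈ range K, f (n + k)‖
  have hV : K * s / 2 ≤ V := by nlinarith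
  have hV2 : (K * s / 2) ^ 2 ≤ N * (K * N + 2 * T) :=
    (pow_le_pow_left₀ (by positivity) hV 2).trans (h2.trans (by gcongr))
  have h4 : (K : ℝ) ^ 2 * s ^ 2 ≤ 16 * N * T := by
    have : (K : ℝ) * (8 * (N : ℝ) ^ 2) ≤ K * (K * s ^ 2) := by gcongr
    nlinarith
  have h5 : (K : ℝ) ^ 4 * s ^ 4 ≤ 128 * N ^ 2 * K ^ 2 * E := by
    calc (K : ℝ) ^ 4 * s ^ 4 = (K ^ 2 * s ^ 2) ^ 2 := by ring
      _ ≤ (16 * N * T) ^ 2 := by gcongr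
      _ = 256 * N ^ 2 * T ^ 2 := by ring
      _ ≤ 256 * N ^ 2 * ((K : ℝ) ^ 2 / 2 * E) := by gcongr
      _ = _ := by ring
  have hE0 : 0 ≤ E := sum_nonneg fun _ _ => sum_nonneg fun _ _ => sq_nonneg _
  have h6 : (K : ℝ) ^ 3 * s ^ 6 ≤ 1152 * N ^ 4 * E := by
    have : (K : ℝ) ^ 2 * (K ^ 3 * s ^ 6) ≤ K ^ 2 * (1152 * N ^ 4 * E) := by
      calc (K : ℝ) ^ 2 * (K ^ 3 * s ^ 6) = K ^ 4 * s ^ 4 * (K * s ^ 2) := by ring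
        _ ≤ 128 * N ^ 2 * K ^ 2 * E * (9 * N ^ 2) := by gcongr
        _ = _ := by ring
    exact le_of_mul_le_mul_left this (by positivity)
  have h7 : E ≤ K ^ 3 * ∑ l ∈ range K, ∑ k ∈ range l, W k l ^ 2 / (l : ℝ) ^ 3 := by
    rw [hE, mul_sum]
    refine sum_le_sum fun l hl => ?_
    rw [mul_sum]
    refine sum_le_sum fun k hk => ?_
    rw [mem_range] at hl hk
    have hl0 : (0 : ℝ) < l := by exact_mod_cast (by omega : 0 < l)
    have hlK : (l : ℝ) ≤ K := by exact_mod_cast hl.le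
    rw [mul_div_assoc', le_div_iff₀ (by positivity), mul_comm]
    gcongr
  have h8 : ∑ l ∈ range K, ∑ k ∈ range l, W k l ^ 2 / (l : ℝ) ^ 3 ≤
      ∑ l ∈ range N, ∑ k ∈ range l, W k l ^ 2 / (l : ℝ) ^ 3 :=
    sum_le_sum_of_subset_of_nonneg (range_subset_range.2 hKN) fun _ _ _ =>
      sum_nonneg fun _ _ => by positivity
  have h9 : (K : ℝ) ^ 3 * s ^ 6 ≤ K ^ 3 * (1152 * N ^ 4 *
      ∑ l ∈ range N, ∑ k ∈ range l, W k l ^ 2 / (l : ℝ) ^ 3) := by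
    calc (K : ℝ) ^ 3 * s ^ 6 ≤ 1152 * N ^ 4 * E := h6
      _ ≤ 1152 * N ^ 4 * (K ^ 3 * ∑ l ∈ range N, ∑ k ∈ range l, W k l ^ 2 / (l : ℝ) ^ 3) := by
        gcongr
        exact h7.trans (by gcongr)
      _ = _ := by ring
  exact le_of_mul_le_mul_left h9 (by positivity)

theorem sum_range_inv_le (N : ℕ) : ∑ l ∈ range N, (l : ℝ)⁻¹ ≤ 1 + Real.log N := by
  refine le_trans ?_ (harmonic_le_one_add_log N)
  rw [harmonic]
  push_cast
  have h : ∑ l ∈ range (N + 1), (l : ℝ)⁻¹ = ∑ i ∈ range N, ((i : ℝ) + 1)⁻¹ := by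
    rw [sum_range_succ']
    simp
  rw [← h]
  exact sum_le_sum_of_subset_of_nonneg (range_subset_range.2 (Nat.le_succ N)) fun _ _ _ =>
    by positivity

section

variable {p : ℕ} [Fact p.Prime]

/-- The sixth moment of the large character sums over factorials. -/
theorem sum_norm_pow_six_le {N : ℕ} (hN : 2 * N < p) :
    ∑ χ : DirichletCharacter ℂ p with
        18 * (N : ℝ) ^ 2 ≤ ‖∑ n ∈ range N, χ ((n + 1).factorial : ZMod p)‖ ^ 3,
      ‖∑ n ∈ range N, χ ((n + 1).factorial : ZMod p)‖ ^ 6 ≤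
      1152 * p * (N : ℝ) ^ 5 * (1 + Real.log N) := by
  set W : DirichletCharacter ℂ p → ℕ → ℕ → ℝ := fun χ k l =>
    ‖∑ n ∈ range N, χ ((n + k + 1).factorial : ZMod p) *
      starRingEnd ℂ (χ ((n + l + 1).factorial : ZMod p))‖ with hW
  calc _ ≤ ∑ χ : DirichletCharacter ℂ p with
        18 * (N : ℝ) ^ 2 ≤ ‖∑ n ∈ range N, χ ((n + 1).factorial : ZMod p)‖ ^ 3,
        1152 * (N : ℝ) ^ 4 * ∑ l ∈ range N, ∑ k ∈ range l, W χ k l ^ 2 / (l : ℝ) ^ 3 :=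
        sum_le_sum fun χ hχ => norm_sum_pow_six_le
          (fun n => χ ((n + 1).factorial : ZMod p)) (fun n => norm_mulChar_le_one χ _) N
          (mem_filter.1 hχ).2
    _ ≤ ∑ χ : DirichletCharacter ℂ p,
        1152 * (N : ℝ) ^ 4 * ∑ l ∈ range N, ∑ k ∈ range l, W χ k l ^ 2 / (l : ℝ) ^ 3 :=
        sum_le_sum_of_subset_of_nonneg (filter_subset _ _) fun _ _ _ => by positivity
    _ = 1152 * (N : ℝ) ^ 4 * ∑ l ∈ range N, ∑ k ∈ range l,
        (∑ χ : DirichletCharacter ℂ p, W χ k l ^ 2) / (l : ℝ) ^ 3 := by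
        rw [← mul_sum, sum_comm]
        congr 1
        refine sum_congr rfl fun l _ => ?_
        rw [sum_comm]
        exact sum_congr rfl fun k _ => (sum_div _ _ _).symm
    _ ≤ 1152 * (N : ℝ) ^ 4 * ∑ l ∈ range N, ∑ k ∈ range l, (p * N * l : ℝ) / (l : ℝ) ^ 3 := by
        gcongr with l hl k hk
        rw [mem_range] at hl hk
        exact sum_norm_sq_correlation_le hk (by omega)
    _ = 1152 * p * (N : ℝ) ^ 5 * ∑ l ∈ range N, (l : ℝ)⁻¹ := by
        rw [mul_sum, mul_sum]
        refine sum_congr rfl fun l _ => ?_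
        rw [sum_const, card_range, nsmul_eq_mul]
        rcases Nat.eq_zero_or_pos l with rfl | hl
        · simp
        · have : (l : ℝ) ≠ 0 := by exact_mod_cast hl.ne'
          field_simp
    _ ≤ _ := by
        gcongr
        exact sum_range_inv_le N

/-- If `a` is not a product of seven factorials of numbers in `[1, N]`, then the nontrivial
characters contribute at least as much as the trivial one. -/
theorem pow_seven_le_sum_of_forall_prod_ne {N : ℕ} (hN : N < p) (a : ZMod p) (ha : a ≠ 0)
    (h : ∀ n : Fin 7 → ℕ, (∀ i, n i < N) → ∏ i, ((n i + 1).factorial : ZMod p) ≠ a) :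
    (N : ℝ) ^ 7 ≤ ∑ χ : DirichletCharacter ℂ p with χ ≠ 1,
      ‖∑ n ∈ range N, χ ((n + 1).factorial : ZMod p)‖ ^ 7 := by
  classical
  set S : DirichletCharacter ℂ p → ℂ := fun χ => ∑ n ∈ range N, χ ((n + 1).factorial : ZMod p)
    with hS
  have hpow : ∀ χ : DirichletCharacter ℂ p, S χ ^ 7 =
      ∑ n ∈ Fintype.piFinset fun _ : Fin 7 => range N,
        χ (∏ i, ((n i + 1).factorial : ZMod p)) := by
    intro χ
    simp_rw [map_prod]
    rw [← prod_univ_sum (fun _ : Fin 7 => range N)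
      (fun _ n => χ ((n + 1).factorial : ZMod p))]
    simp [hS]
  have hzero : ∑ χ : DirichletCharacter ℂ p, χ a⁻¹ * S χ ^ 7 = 0 := by
    simp_rw [hpow, mul_sum]
    rw [sum_comm]
    refine sum_eq_zero fun n hn => ?_
    rw [DirichletCharacter.sum_char_inv_mul_char_eq ℂ ha.isUnit, if_neg]
    exact (h n fun i => mem_range.1 (Fintype.mem_piFinset.1 hn i)).symm
  have hone : (1 : DirichletCharacter ℂ p) a⁻¹ * S 1 ^ 7 = (N : ℂ) ^ 7 := by
    have : S 1 = N := by
      simp only [hS]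
      rw [sum_congr rfl (g := fun _ => (1 : ℂ)) fun n hn =>
        MulChar.one_apply (natCast_factorial_ne_zero (by have := mem_range.1 hn; omega)).isUnit]
      simp
    rw [this, MulChar.one_apply (inv_ne_zero ha).isUnit, one_mul]
  rw [← sum_filter_add_sum_filter_not univ (fun χ : DirichletCharacter ℂ p => χ ≠ 1)] at hzero
  have hfil : (univ.filter fun χ : DirichletCharacter ℂ p => ¬ χ ≠ 1) = {1} := by
    ext; simp
  rw [hfil, sum_singleton, hone] at hzero
  have h2 : (N : ℝ) ^ 7 = ‖∑ χ : DirichletCharacter ℂ p with χ ≠ 1, χ a⁻¹ * S χ ^ 7‖ := by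
    rw [eq_neg_of_add_eq_zero_left hzero]
    simp
  rw [h2]
  refine norm_sum_le_of_le _ fun χ _ => ?_
  rw [norm_mul, norm_pow]
  exact mul_le_of_le_one_left (by positivity) (norm_mulChar_le_one χ _)

theorem card_dirichletCharacter_le : Fintype.card (DirichletCharacter ℂ p) ≤ p := by
  rw [← Nat.card_eq_fintype_card, DirichletCharacter.card_eq_totient_of_hasEnoughRootsOfUnity]
  exact Nat.totient_le p

theorem exists_prod_factorial_eq {N : ℕ} (hN : 1 ≤ N) (hNp : 2 * N < p) (q : ℝ) (hq : 1 ≤ q)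
    (hqp : q ^ 4 = p) (hNq : N + q + 1 < p)
    (hlarge : 324 * p * (N : ℝ) ^ 5 + 4 * √(N * q ^ 3) *
      (1152 * p * (N : ℝ) ^ 5 * (1 + Real.log N)) < (N : ℝ) ^ 7) (a : ZMod p) (ha : a ≠ 0) :
    ∃ n : Fin 7 → ℕ, (∀ i, n i < N) ∧ ∏ i, ((n i + 1).factorial : ZMod p) = a := by
  classical
  by_contra! hcon
  have h0 := pow_seven_le_sum_of_forall_prod_ne (by omega) a ha hcon
  set s : DirichletCharacter ℂ p → ℝ := fun χ =>
    ‖∑ n ∈ range N, χ ((n + 1).factorial : ZMod p)‖ with hs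
  have hs0 : ∀ χ, 0 ≤ s χ := fun χ => norm_nonneg _
  have hsN : ∀ χ, s χ ≤ N := fun χ => by
    simpa using norm_sum_le_of_le (range N) fun n _ =>
      norm_mulChar_le_one χ ((n + 1).factorial : ZMod p)
  rw [← sum_filter_add_sum_filter_not _ (fun χ => 18 * (N : ℝ) ^ 2 ≤ s χ ^ 3)] at h0
  have hbig : ∑ χ ∈ (univ.filter fun χ : DirichletCharacter ℂ p => χ ≠ 1) with
      18 * (N : ℝ) ^ 2 ≤ s χ ^ 3, s χ ^ 7 ≤
      4 * √(N * q ^ 3) * (1152 * p * (N : ℝ) ^ 5 * (1 + Real.log N)) := by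
    calc _ ≤ ∑ χ ∈ (univ.filter fun χ : DirichletCharacter ℂ p => χ ≠ 1) with
          18 * (N : ℝ) ^ 2 ≤ s χ ^ 3, 4 * √(N * q ^ 3) * s χ ^ 6 := by
          refine sum_le_sum fun χ hχ => ?_
          have hχ1 : χ ≠ 1 := (mem_filter.1 (mem_filter.1 hχ).1).2
          rw [pow_succ']
          exact mul_le_mul_of_nonneg_right
            (norm_sum_mulChar_factorial_le χ hχ1 hN q hq hqp hNq) (by have := hs0 χ; positivity)
      _ ≤ ∑ χ : DirichletCharacter ℂ p with 18 * (N : ℝ) ^ 2 ≤ s χ ^ 3,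
            4 * √(N * q ^ 3) * s χ ^ 6 :=
          sum_le_sum_of_subset_of_nonneg (filter_subset_filter _ (filter_subset _ _))
            fun χ _ _ => by have := hs0 χ; positivity
      _ ≤ _ := by
          rw [← mul_sum]
          exact mul_le_mul_of_nonneg_left (sum_norm_pow_six_le hNp) (by positivity)
  have hsmall : ∑ χ ∈ (univ.filter fun χ : DirichletCharacter ℂ p => χ ≠ 1) with
      ¬ 18 * (N : ℝ) ^ 2 ≤ s χ ^ 3, s χ ^ 7 ≤ 324 * p * (N : ℝ) ^ 5 := by
    calc _ ≤ ∑ χ ∈ (univ.filter fun χ : DirichletCharacter ℂ p => χ ≠ 1) with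
          ¬ 18 * (N : ℝ) ^ 2 ≤ s χ ^ 3, 324 * (N : ℝ) ^ 5 := by
          refine sum_le_sum fun χ hχ => ?_
          have h3 := (not_le.1 (mem_filter.1 hχ).2).le
          have := hs0 χ
          calc s χ ^ 7 = (s χ ^ 3) ^ 2 * s χ := by ring
            _ ≤ (18 * (N : ℝ) ^ 2) ^ 2 * N := by gcongr; exact hsN χ
            _ = _ := by ring
      _ ≤ ∑ χ : DirichletCharacter ℂ p, 324 * (N : ℝ) ^ 5 :=
          sum_le_sum_of_subset_of_nonneg (subset_univ _) fun _ _ _ => by positivity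
      _ ≤ _ := by
          have : (Fintype.card (DirichletCharacter ℂ p) : ℝ) ≤ p := by
            exact_mod_cast card_dirichletCharacter_le
          rw [sum_const, card_univ, nsmul_eq_mul]
          calc _ ≤ (p : ℝ) * (324 * N ^ 5) := by gcongr
            _ = _ := by ring
  linarith

end

theorem eventually_threshold (δ : ℝ) (hδ : 0 < δ) :
    ∀ᶠ x : ℝ in Filter.atTop, 100 ≤ x ∧ 100 ≤ x ^ ((1 : ℝ) / 24) ∧
      19728 * (2 + Real.log x) < x ^ (3 / 2 * δ) := by
  have h1 : Filter.Tendsto (fun x : ℝ => x ^ ((1 : ℝ) / 24)) Filter.atTop Filter.atTop :=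
    tendsto_rpow_atTop (by norm_num)
  have h2 : Filter.Tendsto (fun x : ℝ => x ^ (3 / 2 * δ)) Filter.atTop Filter.atTop :=
    tendsto_rpow_atTop (by positivity)
  have h3 := (isLittleO_log_rpow_atTop (show 0 < 3 / 2 * δ by positivity)).bound
    (show (0 : ℝ) < 1 / 39456 by norm_num)
  filter_upwards [Filter.eventually_ge_atTop 100, h1.eventually_ge_atTop 100,
    h2.eventually_gt_atTop 78912, h3] with x hx hx1 hx2 hx3
  refine ⟨hx, hx1, ?_⟩
  rw [Real.norm_eq_abs, Real.norm_eq_abs, abs_of_nonneg (Real.log_nonneg (by linarith)),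
    abs_of_pos (by linarith)] at hx3
  linarith

theorem exists_length_of_threshold {δ x : ℝ} (hδ : 0 < δ) (hδ' : δ ≤ 1 / 24) (hx : 100 ≤ x)
    (hx1 : 100 ≤ x ^ ((1 : ℝ) / 24)) (hx2 : 19728 * (2 + Real.log x) < x ^ (3 / 2 * δ)) :
    ∃ N : ℕ, 1 ≤ N ∧ 2 * (N : ℝ) < x ∧ (N : ℝ) ≤ x ^ ((11 : ℝ) / 12 + δ) ∧
      N + x ^ ((1 : ℝ) / 4) + 1 < x ∧
      324 * x * (N : ℝ) ^ 5 + 4 * √(N * (x ^ ((1 : ℝ) / 4)) ^ 3) *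
        (1152 * x * (N : ℝ) ^ 5 * (1 + Real.log N)) < (N : ℝ) ^ 7 := by
  have hx0 : 0 < x := by linarith
  have hx1' : 1 ≤ x := by linarith
  set y := x ^ ((11 : ℝ) / 12 + δ) with hy
  have hy2 : 2 ≤ y := by
    have : x ^ ((1 : ℝ) / 24) ≤ y := Real.rpow_le_rpow_of_exponent_le hx1' (by linarith)
    linarith
  have hyx : 100 * y ≤ x := by
    calc 100 * y ≤ x ^ ((1 : ℝ) / 24) * x ^ ((23 : ℝ) / 24) := by
          gcongr
          exact Real.rpow_le_rpow_of_exponent_le hx1' (by linarith)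
      _ = x := by rw [← Real.rpow_add hx0]; norm_num
  have hN : (⌊y⌋₊ : ℝ) ≤ y := Nat.floor_le (by linarith)
  have hN' : y / 2 ≤ (⌊y⌋₊ : ℝ) := by have := Nat.lt_floor_add_one y; linarith
  have hN1 : 1 ≤ ⌊y⌋₊ := Nat.le_floor (by norm_num; linarith)
  set N := ⌊y⌋₊
  have hN1' : (1 : ℝ) ≤ N := by exact_mod_cast hN1
  have hq : x ^ ((1 : ℝ) / 4) ≤ y := Real.rpow_le_rpow_of_exponent_le hx1' (by linarith)
  refine ⟨N, hN1, by linarith, hN, by linarith, ?_⟩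
  have hsqrt : √(N * (x ^ ((1 : ℝ) / 4)) ^ 3) = √N * x ^ ((3 : ℝ) / 8) := by
    rw [Real.sqrt_mul (by positivity), ← Real.rpow_natCast, ← Real.rpow_mul hx0.le,
      Real.sqrt_eq_rpow (x ^ _), ← Real.rpow_mul hx0.le]
    norm_num
  have hs1 : 1 ≤ √(N : ℝ) := Real.one_le_sqrt.mpr hN1'
  have ht1 : 1 ≤ x ^ ((3 : ℝ) / 8) := Real.one_le_rpow hx1' (by norm_num)
  have hlog : Real.log N ≤ Real.log x := Real.log_le_log (by linarith) (by linarith)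
  have hlog0 : 0 ≤ Real.log N := Real.log_nonneg hN1'
  have hmain : 4932 * (2 + Real.log x) * (x * x ^ ((3 : ℝ) / 8)) < N * √(N : ℝ) := by
    have e1 : x * x ^ ((3 : ℝ) / 8) = x ^ ((11 : ℝ) / 8) := by
      nth_rewrite 1 [← Real.rpow_one x]
      rw [← Real.rpow_add hx0]; norm_num
    have e2 : x ^ ((11 : ℝ) / 8) * x ^ (3 / 2 * δ) = y * √y := by
      rw [hy, Real.sqrt_eq_rpow, ← Real.rpow_mul hx0.le, ← Real.rpow_add hx0,
        ← Real.rpow_add hx0]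
      congr 1; ring
    have e3 : √y / 2 ≤ √(N : ℝ) := by
      apply Real.le_sqrt_of_sq_le
      rw [div_pow, Real.sq_sqrt (by linarith)]
      linarith
    have e4 : y / 2 * (√y / 2) ≤ N * √(N : ℝ) := by gcongr
    have e5 : 0 < x ^ ((11 : ℝ) / 8) := by positivity
    rw [e1]
    nlinarith [mul_lt_mul_of_pos_left hx2 e5]
  have hss : √(N : ℝ) * √(N : ℝ) = N := Real.mul_self_sqrt (by linarith)
  rw [hsqrt]
  set s := √(N : ℝ)
  set t := x ^ ((3 : ℝ) / 8)
  have h1 : 324 * x ≤ 324 * (s * t * x) := by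
    have : 1 ≤ s * t := one_le_mul_of_one_le_of_one_le hs1 ht1
    nlinarith
  have h2 : 4608 * (s * t * x) * (1 + Real.log N) ≤ 4608 * (s * t * x) * (1 + Real.log x) := by
    gcongr
  have h3 : 0 < s * t * x := by positivity
  have h4 : s * (4932 * (2 + Real.log x) * (x * t)) < s * (N * s) :=
    mul_lt_mul_of_pos_left hmain (by linarith)
  have h5 : s * (N * s) = (N : ℝ) ^ 2 := by rw [sq, ← hss]; ring
  have h6 : 324 * x + 4608 * (s * t * x) * (1 + Real.log N) < (N : ℝ) ^ 2 := by
    have : 0 ≤ (s * t * x) * Real.log x := mul_nonneg h3.le (hlog0.trans hlog)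
    nlinarith
  have h7 := mul_lt_mul_of_pos_right h6 (show (0 : ℝ) < (N : ℝ) ^ 5 by positivity)
  nlinarith

end

/-- For every `ε > 0` and every sufficiently large prime `p`, every integer
`a ≢ 0 (mod p)` is a product of seven factorials `n_1! ⋯ n_7! (mod p)` with
`n_i ≤ p^{11/12 + ε}` for all `i`. -/
theorem seven_factorials_represent_all_classes (ε : ℝ) (hε : 0 < ε) :
    ∃ p₀ : ℕ, ∀ p : ℕ, p.Prime → p₀ ≤ p →
      ∀ a : ℤ, ¬ (p : ℤ) ∣ a →
        ∃ n : Fin 7 → ℕ, (∀ i, 0 < n i ∧ (n i : ℝ) ≤ (p : ℝ) ^ ((11 : ℝ) / 12 + ε)) ∧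
          (∏ i, ((n i).factorial : ZMod p)) = (a : ZMod p) := by
  have hδ : 0 < min ε (1 / 24) := lt_min hε (by norm_num)
  obtain ⟨p₀, hp₀⟩ := Filter.eventually_atTop.mp
    (tendsto_natCast_atTop_atTop.eventually (eventually_threshold _ hδ))
  refine ⟨p₀, fun p hp hle a ha => ?_⟩
  obtain ⟨h100, hx1, hx2⟩ := hp₀ p hle
  obtain ⟨N, hN1, hN2, hN3, hN4, hN5⟩ :=
    exists_length_of_threshold hδ (min_le_right _ _) h100 hx1 hx2
  have : Fact p.Prime := ⟨hp⟩
  have hp1 : (1 : ℝ) ≤ p := by linarith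
  obtain ⟨n, hn, hprod⟩ := exists_prod_factorial_eq hN1 (by exact_mod_cast hN2)
    ((p : ℝ) ^ ((1 : ℝ) / 4)) (Real.one_le_rpow hp1 (by norm_num))
    (by rw [← Real.rpow_natCast, ← Real.rpow_mul (by linarith)]; norm_num)
    hN4 hN5 (a : ZMod p) (fun h => ha ((ZMod.intCast_zmod_eq_zero_iff_dvd a p).mp h))
  refine ⟨fun i => n i + 1, fun i => ⟨Nat.succ_pos _, ?_⟩, hprod⟩
  have h1 : ((n i + 1 : ℕ) : ℝ) ≤ N := by exact_mod_cast hn i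
  exact (h1.trans hN3).trans (Real.rpow_le_rpow_of_exponent_le hp1 (by
    have := min_le_left ε (1 / 24); linarith))
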